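/- For every β ∈ ℝ, lim_{d→∞} limsup_{n→∞} (1/n) | E_g[⟨H_SK(σ)⟩^bis_{β,g}] − (1/√d) E_A[⟨H_d(σ)⟩^bis_{β/√d,A}] | = 0, where the inner Gibbs averages are over one sample from the bisection Gibbs measures μ^bis_{β,g} and μ^bis_{β/√d,A} respectively, and the outer expectations are over the SK disorder g and the sparse disorder A. -/

import Mathlib

open MeasureTheory ProbabilityTheory Filter

noncomputable section

/-- The value of a ±1 spin encoded as a Boolean. -/
def spin (b : Bool) : ℝ := if b then 1 else -1

/-- The Ising Hamiltonian `H(σ; X) = ∑_{i,j} X i j σ(i) σ(j)`. -/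
def Ham {n : ℕ} (X : Fin n → Fin n → ℝ) (σ : Fin n → Bool) : ℝ :=
  ∑ i, ∑ j, X i j * spin (σ i) * spin (σ j)

/-- The partition function `Z(β, X)`. -/
def Zpart {n : ℕ} (β : ℝ) (X : Fin n → Fin n → ℝ) : ℝ :=
  ∑ σ : Fin n → Bool, Real.exp (-β * Ham X σ)

/-- The Gibbs probability mass function `μ_{β,X}(σ)`. -/
def gibbs {n : ℕ} (β : ℝ) (X : Fin n → Fin n → ℝ) (σ : Fin n → Bool) : ℝ :=
  Real.exp (-β * Ham X σ) / Zpart β X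

/-- A configuration is a bisection if `|∑ i σ(i)| ≤ 1`. -/
def isBis {n : ℕ} (σ : Fin n → Bool) : Prop := |∑ i, spin (σ i)| ≤ 1

open scoped Classical in
/-- The bisection partition function `Z^bis(β, X)`. -/
def ZpartBis {n : ℕ} (β : ℝ) (X : Fin n → Fin n → ℝ) : ℝ :=
  ∑ σ : Fin n → Bool, if isBis σ then Real.exp (-β * Ham X σ) else 0

open scoped Classical in
/-- The bisection Gibbs probability mass function `μ^bis_{β,X}(σ)`. -/
def gibbsBis {n : ℕ} (β : ℝ) (X : Fin n → Fin n → ℝ) (σ : Fin n → Bool) : ℝ :=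
  if isBis σ then Real.exp (-β * Ham X σ) / ZpartBis β X else 0

/-- The overlap `R_{1,2}(σ1, σ2) = (1/n) ∑ i σ1(i) σ2(i)`. -/
def overlap {n : ℕ} (σ1 σ2 : Fin n → Bool) : ℝ :=
  (1 / (n : ℝ)) * ∑ i, spin (σ1 i) * spin (σ2 i)

/-- Gibbs average of a one-variable observable. -/
def avg1 {n : ℕ} (β : ℝ) (X : Fin n → Fin n → ℝ) (f : (Fin n → Bool) → ℝ) : ℝ :=
  ∑ σ : Fin n → Bool, f σ * gibbs β X σ

/-- Bisection Gibbs average of a one-variable observable. -/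
def avg1Bis {n : ℕ} (β : ℝ) (X : Fin n → Fin n → ℝ) (f : (Fin n → Bool) → ℝ) : ℝ :=
  ∑ σ : Fin n → Bool, f σ * gibbsBis β X σ

/-- Coupled Gibbs average: `σ1 ~ μ_{β,X}`, `σ2 ~ μ_{β,Y}` independent. -/
def avg2c {n : ℕ} (β : ℝ) (X Y : Fin n → Fin n → ℝ)
    (f : (Fin n → Bool) → (Fin n → Bool) → ℝ) : ℝ :=
  ∑ σ1 : Fin n → Bool, ∑ σ2 : Fin n → Bool, f σ1 σ2 * gibbs β X σ1 * gibbs β Y σ2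

/-- Gibbs average of a two-replica observable. -/
def avg2 {n : ℕ} (β : ℝ) (X : Fin n → Fin n → ℝ)
    (f : (Fin n → Bool) → (Fin n → Bool) → ℝ) : ℝ :=
  avg2c β X X f

/-- Coupled bisection Gibbs average. -/
def avg2cBis {n : ℕ} (β : ℝ) (X Y : Fin n → Fin n → ℝ)
    (f : (Fin n → Bool) → (Fin n → Bool) → ℝ) : ℝ :=
  ∑ σ1 : Fin n → Bool, ∑ σ2 : Fin n → Bool, f σ1 σ2 * gibbsBis β X σ1 * gibbsBis β Y σ2

/-- Bisection Gibbs average of a two-replica observable. -/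
def avg2Bis {n : ℕ} (β : ℝ) (X : Fin n → Fin n → ℝ)
    (f : (Fin n → Bool) → (Fin n → Bool) → ℝ) : ℝ :=
  avg2cBis β X X f

/-- The SK disorder: i.i.d. entries `N(0, 1/(2n))`. -/
def skMeasure (n : ℕ) : Measure (Fin n → Fin n → ℝ) :=
  Measure.pi fun _ => Measure.pi fun _ => gaussianReal 0 (1 / (2 * n))

/-- The law of the pair `(g, g')` of independent SK disorders. -/
def skPair (n : ℕ) : Measure ((Fin n → Fin n → ℝ) × (Fin n → Fin n → ℝ)) :=
  (skMeasure n).prod (skMeasure n)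

/-- The perturbed SK disorder `g_t = √(1-t) g + √t g'`. -/
def skPerturb {n : ℕ} (t : ℝ) (g g' : Fin n → Fin n → ℝ) : Fin n → Fin n → ℝ :=
  fun i j => Real.sqrt (1 - t) * g i j + Real.sqrt t * g' i j

/-- The sparse disorder: i.i.d. entries `Poisson(d/(2n))`. -/
def sparseMeasure (n : ℕ) (d : ℝ) : Measure (Fin n → Fin n → ℕ) :=
  Measure.pi fun _ => Measure.pi fun _ => poissonMeasure (d / (2 * n)).toNNReal

/-- The law of the triple `(A^{(1-t)}, A^{(t,1)}, A^{(t,2)})` of independent sparse disorders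
used to build the coupled pair `A = A^{(1-t)} + A^{(t,1)}`, `A_t = A^{(1-t)} + A^{(t,2)}`. -/
def coupledSparse (n : ℕ) (d t : ℝ) :
    Measure ((Fin n → Fin n → ℕ) × (Fin n → Fin n → ℕ) × (Fin n → Fin n → ℕ)) :=
  (sparseMeasure n ((1 - t) * d)).prod
    ((sparseMeasure n (t * d)).prod (sparseMeasure n (t * d)))

/-- View an ℕ-valued matrix as a real matrix. -/
def natMat {n : ℕ} (A : Fin n → Fin n → ℕ) : Fin n → Fin n → ℝ := fun i j => (A i j : ℝ)

/-- The Gibbs measure `μ_{β,X}` as a probability measure on configurations. -/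
def gibbsMeasure {n : ℕ} (β : ℝ) (X : Fin n → Fin n → ℝ) : Measure (Fin n → Bool) :=
  ∑ σ : Fin n → Bool, ENNReal.ofReal (gibbs β X σ) • Measure.dirac σ

/-- The bisection Gibbs measure `μ^bis_{β,X}` as a measure on configurations. -/
def gibbsBisMeasure {n : ℕ} (β : ℝ) (X : Fin n → Fin n → ℝ) : Measure (Fin n → Bool) :=
  ∑ σ : Fin n → Bool, ENNReal.ofReal (gibbsBis β X σ) • Measure.dirac σ

/-- Normalized Wasserstein distance `W_{2,n}` between measures on `{-1,1}^n`. -/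
def W2 (n : ℕ) (μ1 μ2 : Measure (Fin n → Bool)) : ℝ :=
  sInf {r : ℝ | ∃ π : Measure ((Fin n → Bool) × (Fin n → Bool)),
    IsProbabilityMeasure π ∧ π.map Prod.fst = μ1 ∧ π.map Prod.snd = μ2 ∧
    r = Real.sqrt (∫ p, (1 / (n : ℝ)) * ∑ i, (spin (p.1 i) - spin (p.2 i)) ^ 2 ∂π)}

open scoped Classical in
/-- Overlap-restricted coupled partition function `Z^S_{X,Y}`. -/
def Zres {n : ℕ} (β : ℝ) (S : Set ℝ) (X Y : Fin n → Fin n → ℝ) : ℝ :=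
  ∑ σ1 : Fin n → Bool, ∑ σ2 : Fin n → Bool,
    if overlap σ1 σ2 ∈ S then Real.exp (-β * (Ham X σ1 + Ham Y σ2)) else 0

open scoped Classical in
/-- Overlap-restricted coupled bisection partition function `Z^{S,bis}_{X,Y}`. -/
def ZresBis {n : ℕ} (β : ℝ) (S : Set ℝ) (X Y : Fin n → Fin n → ℝ) : ℝ :=
  ∑ σ1 : Fin n → Bool, ∑ σ2 : Fin n → Bool,
    if isBis σ1 ∧ isBis σ2 ∧ overlap σ1 σ2 ∈ S
    then Real.exp (-β * (Ham X σ1 + Ham Y σ2)) else 0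

/-- The matrix with a single `1` in position `(i,j)`. -/
def Jmat {n : ℕ} (i j : Fin n) : Fin n → Fin n → ℝ :=
  fun a b => if a = i ∧ b = j then 1 else 0

end

/-- The logarithm of the partition function with log-weights `w` on a finite set. -/
noncomputable def logSumExp {α : Type*} (S : Finset α) (w : α → ℝ) : ℝ :=
  Real.log (∑ σ ∈ S, Real.exp (w σ))

/-- The average of `f` under the probability on `S` with weights proportional to `exp w`. -/
noncomputable def expAvg {α : Type*} (S : Finset α) (w f : α → ℝ) : ℝ :=
  (∑ σ ∈ S, Real.exp (w σ) * f σ) / ∑ σ ∈ S, Real.exp (w σ)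

section LogSumExp

variable {α : Type*} {S : Finset α}

lemma sum_exp_pos (hS : S.Nonempty) (w : α → ℝ) : 0 < ∑ σ ∈ S, Real.exp (w σ) :=
  Finset.sum_pos (fun _ _ => Real.exp_pos _) hS

lemma abs_expAvg_le (hS : S.Nonempty) (w f : α → ℝ) {B : ℝ} (hB : ∀ σ ∈ S, |f σ| ≤ B) :
    |expAvg S w f| ≤ B := by
  have hpos := sum_exp_pos hS w
  rw [expAvg, abs_div, abs_of_pos hpos, div_le_iff₀ hpos, Finset.mul_sum]
  refine (Finset.abs_sum_le_sum_abs _ _).trans (Finset.sum_le_sum fun σ hσ => ?_)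
  rw [abs_mul, abs_of_pos (Real.exp_pos _), mul_comm]
  exact mul_le_mul_of_nonneg_right (hB σ hσ) (Real.exp_pos _).le

lemma expAvg_mul_left (w f : α → ℝ) (c : ℝ) :
    expAvg S w (fun σ => c * f σ) = c * expAvg S w f := by
  simp only [expAvg, mul_left_comm _ c, ← Finset.mul_sum, mul_div_assoc]

/-- The tangent-line inequality for the convex function `logSumExp`. -/
lemma logSumExp_add_expAvg_le (hS : S.Nonempty) (w y : α → ℝ) :
    logSumExp S w + expAvg S w y ≤ logSumExp S (fun σ => w σ + y σ) := by
  have h0 := sum_exp_pos hS w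
  have h1 := sum_exp_pos hS (fun σ => w σ + y σ)
  set m := expAvg S w y with hm
  have hmul : ∑ σ ∈ S, Real.exp (w σ) * y σ = m * ∑ σ ∈ S, Real.exp (w σ) := by
    rw [hm, expAvg, div_mul_cancel₀ _ h0.ne']
  have key : (∑ σ ∈ S, Real.exp (w σ)) * Real.exp m ≤ ∑ σ ∈ S, Real.exp (w σ + y σ) := by
    have : ∑ σ ∈ S, Real.exp (w σ) * Real.exp m * (1 + (y σ - m))
        ≤ ∑ σ ∈ S, Real.exp (w σ + y σ) := by
      refine Finset.sum_le_sum fun σ _ => ?_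
      have h2 := Real.add_one_le_exp (y σ - m)
      have : Real.exp (w σ + y σ) = Real.exp (w σ) * Real.exp m * Real.exp (y σ - m) := by
        rw [← Real.exp_add, ← Real.exp_add]; ring_nf
      rw [this]
      refine mul_le_mul_of_nonneg_left (by linarith) (by positivity)
    refine le_trans (le_of_eq ?_) this
    have : ∀ σ, Real.exp (w σ) * Real.exp m * (1 + (y σ - m))
        = Real.exp m * (1 - m) * Real.exp (w σ) + Real.exp m * (Real.exp (w σ) * y σ) := by
      intro σ; ring
    simp only [this, Finset.sum_add_distrib, ← Finset.mul_sum, hmul]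
    ring
  have := Real.log_le_log (by positivity) key
  rwa [Real.log_mul h0.ne' (Real.exp_pos _).ne', Real.log_exp] at this

lemma abs_logSumExp_add_sub_le (hS : S.Nonempty) (w y : α → ℝ) {B : ℝ}
    (hB : ∀ σ ∈ S, |y σ| ≤ B) :
    |logSumExp S (fun σ => w σ + y σ) - logSumExp S w| ≤ B := by
  have h1 := logSumExp_add_expAvg_le hS w y
  have h2 := logSumExp_add_expAvg_le hS (fun σ => w σ + y σ) (fun σ => - y σ)
  simp only [add_neg_cancel_right] at h2
  have h3 := abs_le.1 (abs_expAvg_le hS w y hB)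
  have h4 := abs_le.1 (abs_expAvg_le hS (fun σ => w σ + y σ) (fun σ => - y σ)
    (B := B) (by simpa using hB))
  rw [abs_le]
  constructor <;> linarith [h3.1, h4.1]

lemma abs_logSumExp_le (hS : S.Nonempty) (y : α → ℝ) {B : ℝ} (hB : ∀ σ ∈ S, |y σ| ≤ B) :
    |logSumExp S y| ≤ Real.log S.card + B := by
  have h := abs_logSumExp_add_sub_le hS (fun _ => 0) y hB
  have h0 : logSumExp S (fun _ => 0) = Real.log S.card := by simp [logSumExp]
  simp only [zero_add, h0] at h
  have hn : 0 ≤ Real.log S.card := Real.log_natCast_nonneg _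
  rw [abs_le] at h ⊢
  constructor <;> linarith [h.1, h.2]

lemma logSumExp_mono {T : Finset α} (hS : S.Nonempty) (h : S ⊆ T) (w : α → ℝ) :
    logSumExp S w ≤ logSumExp T w :=
  Real.log_le_log (sum_exp_pos hS w)
    (Finset.sum_le_sum_of_subset_of_nonneg h fun _ _ _ => (Real.exp_pos _).le)

lemma measurable_logSumExp {Ω : Type*} [MeasurableSpace Ω] {y : Ω → α → ℝ}
    (hy : ∀ σ, Measurable fun ω => y ω σ) : Measurable fun ω => logSumExp S (y ω) := by
  unfold logSumExp
  refine Real.measurable_log.comp (Finset.measurable_sum _ fun σ _ => ?_)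
  exact Real.measurable_exp.comp (hy σ)

lemma measurable_expAvg {Ω : Type*} [MeasurableSpace Ω] {w y : Ω → α → ℝ}
    (hw : ∀ σ, Measurable fun ω => w ω σ) (hy : ∀ σ, Measurable fun ω => y ω σ) :
    Measurable fun ω => expAvg S (w ω) (y ω) := by
  unfold expAvg
  refine Measurable.div (Finset.measurable_sum _ fun σ _ => ?_)
    (Finset.measurable_sum _ fun σ _ => ?_)
  · exact (Real.measurable_exp.comp (hw σ)).mul (hy σ)
  · exact Real.measurable_exp.comp (hw σ)

/-- Second-order Taylor bound on `[0, 1]` with a crude constant. -/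
lemma abs_taylor_two_le {u u₁ u₂ u₃ : ℝ → ℝ} {M : ℝ} (h₀ : ∀ r, HasDerivAt u (u₁ r) r)
    (h₁ : ∀ r, HasDerivAt u₁ (u₂ r) r) (h₂ : ∀ r, HasDerivAt u₂ (u₃ r) r)
    (hM : ∀ r, |u₃ r| ≤ M) :
    |u 1 - u 0 - u₁ 0 - u₂ 0 / 2| ≤ M := by
  have hM0 : 0 ≤ M := (abs_nonneg _).trans (hM 0)
  have mvt : ∀ {f f' : ℝ → ℝ}, (∀ r, HasDerivAt f (f' r) r) →
      (∀ r ∈ Set.Icc (0 : ℝ) 1, |f' r| ≤ M) → ∀ r ∈ Set.Icc (0 : ℝ) 1, |f r - f 0| ≤ M := by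
    intro f f' hf hb r hr
    have := (convex_Icc (0 : ℝ) 1).norm_image_sub_le_of_norm_hasDerivWithin_le
      (f := f) (f' := f') (C := M) (fun x _ => (hf x).hasDerivWithinAt) hb
      (Set.left_mem_Icc.2 zero_le_one) hr
    simp only [Real.norm_eq_abs, sub_zero] at this
    refine this.trans ?_
    rw [abs_of_nonneg hr.1]
    exact mul_le_of_le_one_right hM0 hr.2
  have b₂ := mvt h₂ (fun r _ => hM r)
  have b₁ := mvt (f := fun r => u₁ r - u₂ 0 * r) (f' := fun r => u₂ r - u₂ 0)
    (fun r => ((h₁ r).sub ((hasDerivAt_id r).const_mul (u₂ 0))).congr_deriv (by simp)) b₂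
  have b₀ := mvt (f := fun r => u r - u₁ 0 * r - u₂ 0 / 2 * r ^ 2)
    (f' := fun r => u₁ r - u₂ 0 * r - u₁ 0)
    (fun r => by
      have := ((h₀ r).sub ((hasDerivAt_id r).const_mul (u₁ 0))).sub
        (((hasDerivAt_id r).pow 2).const_mul (u₂ 0 / 2))
      refine this.congr_deriv ?_
      simp; ring)
    (fun r hr => by simpa using b₁ r hr)
  have := b₀ 1 (Set.right_mem_Icc.2 zero_le_one)
  simp only [mul_one, one_pow, mul_zero, sub_zero] at this
  convert this using 2
  ring

/-- Second-order expansion of `logSumExp`, with an error cubic in the perturbation. -/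
lemma abs_logSumExp_taylor_le (hS : S.Nonempty) (w y : α → ℝ) {B : ℝ}
    (hB : ∀ σ ∈ S, |y σ| ≤ B) :
    |logSumExp S (fun σ => w σ + y σ) - logSumExp S w - expAvg S w y
      - (expAvg S w (fun σ => y σ ^ 2) - expAvg S w y ^ 2) / 2| ≤ 6 * B ^ 3 := by
  obtain ⟨σ₀, hσ₀⟩ := hS
  have hS : S.Nonempty := ⟨σ₀, hσ₀⟩
  have hB0 : 0 ≤ B := (abs_nonneg _).trans (hB σ₀ hσ₀)
  let D : ℕ → ℝ → ℝ := fun k r => ∑ σ ∈ S, Real.exp (w σ + r * y σ) * y σ ^ k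
  have hD : ∀ k r, HasDerivAt (D k) (D (k + 1) r) r := by
    intro k r
    refine HasDerivAt.fun_sum fun σ _ => ?_
    have h : HasDerivAt (fun r => w σ + r * y σ) (y σ) r := by
      simpa using ((hasDerivAt_id r).mul_const (y σ)).const_add (w σ)
    refine (h.exp.mul_const (y σ ^ k)).congr_deriv ?_
    ring
  have hD0 : ∀ r, 0 < D 0 r := fun r => by
    simpa [D] using sum_exp_pos hS (fun σ => w σ + r * y σ)
  let a : ℕ → ℝ → ℝ := fun k r => D k r / D 0 r
  have ha : ∀ k r, HasDerivAt (a k) (a (k + 1) r - a k r * a 1 r) r := by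
    intro k r
    refine ((hD k r).div (hD 0 r) (hD0 r).ne').congr_deriv ?_
    have := (hD0 r).ne'
    simp only [a]
    field_simp
  have hab : ∀ k r, |a k r| ≤ B ^ k := by
    intro k r
    have := abs_expAvg_le hS (fun σ => w σ + r * y σ) (fun σ => y σ ^ k) (B := B ^ k)
      (fun σ hσ => by rw [abs_pow]; exact pow_le_pow_left₀ (abs_nonneg _) (hB σ hσ) k)
    simpa [a, D, expAvg] using this
  have key := abs_taylor_two_le (u := fun r => Real.log (D 0 r)) (u₁ := a 1)
    (u₂ := fun r => a 2 r - a 1 r * a 1 r)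
    (u₃ := fun r => a 3 r - a 2 r * a 1 r
      - ((a 2 r - a 1 r * a 1 r) * a 1 r + a 1 r * (a 2 r - a 1 r * a 1 r)))
    (M := 6 * B ^ 3)
    (fun r => (hD 0 r).log (hD0 r).ne') (ha 1)
    (fun r => (ha 2 r).sub ((ha 1 r).mul (ha 1 r)))
    (fun r => by
      have e : a 3 r - a 2 r * a 1 r
          - ((a 2 r - a 1 r * a 1 r) * a 1 r + a 1 r * (a 2 r - a 1 r * a 1 r))
          = a 3 r - 3 * (a 2 r * a 1 r) + 2 * (a 1 r) ^ 3 := by ring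
      rw [e]
      have h3 := hab 3 r
      have h21 : |a 2 r * a 1 r| ≤ B ^ 3 := by
        rw [abs_mul, show B ^ 3 = B ^ 2 * B ^ 1 by ring]
        exact mul_le_mul (hab 2 r) (hab 1 r) (abs_nonneg _) (by positivity)
      have h13 : |a 1 r ^ 3| ≤ B ^ 3 := by
        rw [abs_pow]
        exact pow_le_pow_left₀ (abs_nonneg _) (by simpa using hab 1 r) 3
      rw [abs_le] at *
      constructor <;> linarith [h3.1, h3.2, h21.1, h21.2, h13.1, h13.2])
  convert key using 2
  simp [logSumExp, expAvg, D, a]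
  ring

end LogSumExp

section GaussianComparison

open scoped NNReal

variable {α κ κ' : Type*} [Fintype κ] [Fintype κ'] {S : Finset α}

/-- The covariance `∑ k, c σ k * c τ k` of the Gaussian process with coefficients `c`. -/
def coeffCov (c : α → κ → ℝ) (σ τ : α) : ℝ := ∑ k, c σ k * c τ k

/-- The law of `σ ↦ ∑ k, c σ k * z k`, where the `z k` are i.i.d. `N(0, v)`. -/
noncomputable def gaussLaw (c : α → κ → ℝ) (v : ℝ≥0) : Measure (α → ℝ) :=
  (Measure.pi fun _ : κ => gaussianReal 0 v).map fun z σ => ∑ k, c σ k * z k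

lemma measurable_linComb (c : α → κ → ℝ) :
    Measurable fun (z : κ → ℝ) (σ : α) => ∑ k, c σ k * z k := by
  fun_prop

instance (c : α → κ → ℝ) (v : ℝ≥0) : IsProbabilityMeasure (gaussLaw c v) :=
  Measure.isProbabilityMeasure_map (measurable_linComb c).aemeasurable

lemma pi_gaussianReal_eq_map (v : ℝ≥0) :
    (Measure.pi fun _ : κ => gaussianReal 0 v)
      = (Measure.pi fun _ : κ => gaussianReal 0 1).map fun z k => Real.sqrt v * z k := by
  rw [Measure.pi_map_pi (fun _ => by fun_prop)]
  congr with k : 1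
  rw [gaussianReal_map_const_mul]
  simp only [mul_zero, mul_one]
  congr 1
  ext
  simp

lemma pi_gaussianReal_conv (u v : ℝ≥0) :
    (Measure.pi fun _ : κ => gaussianReal 0 u) ∗ (Measure.pi fun _ : κ => gaussianReal 0 v)
      = Measure.pi fun _ : κ => gaussianReal 0 (u + v) := by
  rw [Measure.conv, ← (measurePreserving_arrowProdEquivProdArrow ℝ ℝ κ
    (fun _ => gaussianReal 0 u) (fun _ => gaussianReal 0 v)).map_eq,
    Measure.map_map (by fun_prop) (MeasurableEquiv.measurable _)]
  have : ((fun x : (κ → ℝ) × (κ → ℝ) => x.1 + x.2) ∘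
      MeasurableEquiv.arrowProdEquivProdArrow ℝ ℝ κ) = fun x k => (x k).1 + (x k).2 := rfl
  have hc : Measure.map (fun x : ℝ × ℝ => x.1 + x.2) ((gaussianReal 0 u).prod (gaussianReal 0 v))
      = gaussianReal 0 (u + v) := by
    have := gaussianReal_conv_gaussianReal (m₁ := 0) (m₂ := 0) (v₁ := u) (v₂ := v)
    simpa [Measure.conv] using this
  rw [this, Measure.pi_map_pi (f := fun _ (x : ℝ × ℝ) => x.1 + x.2) (fun _ => by fun_prop), hc]

lemma gaussLaw_conv (c : α → κ → ℝ) (u v : ℝ≥0) :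
    gaussLaw c u ∗ gaussLaw c v = gaussLaw c (u + v) := by
  rw [gaussLaw, gaussLaw, gaussLaw, ← pi_gaussianReal_conv]
  let L : (κ → ℝ) →+ (α → ℝ) :=
    { toFun := fun z σ => ∑ k, c σ k * z k
      map_zero' := by ext; simp
      map_add' := fun x y => by ext; simp [mul_add, Finset.sum_add_distrib] }
  exact (Measure.map_conv_addMonoidHom L (measurable_linComb c)).symm

lemma integral_gaussLaw (c : α → κ → ℝ) (v : ℝ≥0) {F : (α → ℝ) → ℝ} (hF : Measurable F) :
    ∫ y, F y ∂gaussLaw c v = ∫ z, F (fun σ => Real.sqrt v * ∑ k, c σ k * z k)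
      ∂(Measure.pi fun _ : κ => gaussianReal 0 1) := by
  have hm : Measurable fun (z : κ → ℝ) k => Real.sqrt v * z k := by fun_prop
  rw [gaussLaw, pi_gaussianReal_eq_map, Measure.map_map (measurable_linComb c) hm,
    integral_map ((measurable_linComb c).comp hm).aemeasurable hF.aestronglyMeasurable]
  simp only [Function.comp_def, Finset.mul_sum, mul_left_comm]

lemma gaussLaw_zero (c : α → κ → ℝ) : gaussLaw c 0 = Measure.dirac 0 := by
  have hm : Measurable fun (z : κ → ℝ) k => Real.sqrt ((0 : ℝ≥0) : ℝ) * z k := by fun_prop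
  rw [gaussLaw, pi_gaussianReal_eq_map, Measure.map_map (measurable_linComb c) hm]
  have : ((fun (z : κ → ℝ) (σ : α) => ∑ k, c σ k * z k) ∘
      fun (z : κ → ℝ) k => Real.sqrt ((0 : ℝ≥0) : ℝ) * z k) = fun _ => 0 := by
    ext z σ; simp
  rw [this, Measure.map_const]
  simp

lemma memLp_eval_gaussianPi (k : κ) (p : ℝ≥0) :
    MemLp (fun z : κ → ℝ => z k) p (Measure.pi fun _ : κ => gaussianReal 0 1) :=
  (memLp_id_gaussianReal p).comp_measurePreserving (measurePreserving_eval _ k)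

lemma integrable_eval_gaussLaw (c : α → κ → ℝ) (v : ℝ≥0) (σ : α) :
    Integrable (fun y : α → ℝ => y σ) (gaussLaw c v) := by
  have hm : Measurable fun (z : κ → ℝ) k => Real.sqrt v * z k := by fun_prop
  rw [gaussLaw, pi_gaussianReal_eq_map, Measure.map_map (measurable_linComb c) hm,
    integrable_map_measure (Measurable.aestronglyMeasurable (by fun_prop))
      ((measurable_linComb c).comp hm).aemeasurable]
  refine integrable_finsetSum _ fun k _ => Integrable.const_mul (Integrable.const_mul ?_ _) _
  exact memLp_one_iff_integrable.1 (by simpa using memLp_eval_gaussianPi k 1)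

lemma integral_eval_mul_eval_gaussianPi [DecidableEq κ] (k l : κ) :
    ∫ z : κ → ℝ, z k * z l ∂(Measure.pi fun _ : κ => gaussianReal 0 1)
      = if k = l then 1 else 0 := by
  split_ifs with h
  · subst h
    have := integral_comp_eval (μ := fun _ : κ => gaussianReal 0 1) (i := k)
      (f := fun x : ℝ => x * x) (by fun_prop)
    rw [this]
    have hv := variance_fun_id_gaussianReal (μ := 0) (v := 1)
    rw [variance_eq_integral (by fun_prop)] at hv
    simpa [integral_id_gaussianReal, sq] using hv
  · have hind : iIndepFun (fun (i : κ) (z : κ → ℝ) => z i)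
        (Measure.pi fun _ : κ => gaussianReal 0 1) :=
      iIndepFun_pi (X := fun _ x => x) (fun _ => by fun_prop)
    have := (hind.indepFun h).integral_fun_mul_eq_mul_integral
      (measurable_pi_apply k).aestronglyMeasurable (measurable_pi_apply l).aestronglyMeasurable
    rw [this]
    have h0 := integral_comp_eval (μ := fun _ : κ => gaussianReal 0 1) (i := k)
      (f := fun x : ℝ => x) (by fun_prop)
    rw [h0]
    simp [integral_id_gaussianReal]

lemma integral_eval_gaussLaw (c : α → κ → ℝ) (v : ℝ≥0) (σ : α) :
    ∫ y, y σ ∂gaussLaw c v = 0 := by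
  rw [integral_gaussLaw c v (F := fun y => y σ) (by fun_prop), integral_const_mul,
    integral_finsetSum]
  · refine mul_eq_zero_of_right _ (Finset.sum_eq_zero fun k _ => ?_)
    rw [integral_const_mul, integral_comp_eval (μ := fun _ : κ => gaussianReal 0 1) (i := k)
      (f := fun x : ℝ => x) (by fun_prop)]
    simp [integral_id_gaussianReal]
  · intro k _
    exact (memLp_one_iff_integrable.1 (by simpa using memLp_eval_gaussianPi k 1)).const_mul _

lemma integrable_eval_mul_eval_gaussianPi (k l : κ) :
    Integrable (fun z : κ → ℝ => z k * z l) (Measure.pi fun _ : κ => gaussianReal 0 1) :=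
  MemLp.integrable_mul (p := 2) (q := 2) (by simpa using memLp_eval_gaussianPi k 2)
    (by simpa using memLp_eval_gaussianPi l 2)

lemma integrable_eval_mul_eval_gaussLaw (c : α → κ → ℝ) (v : ℝ≥0) (σ τ : α) :
    Integrable (fun y => y σ * y τ) (gaussLaw c v) := by
  have hm : Measurable fun (z : κ → ℝ) k => Real.sqrt v * z k := by fun_prop
  rw [gaussLaw, pi_gaussianReal_eq_map, Measure.map_map (measurable_linComb c) hm,
    integrable_map_measure (Measurable.aestronglyMeasurable (by fun_prop))
      ((measurable_linComb c).comp hm).aemeasurable]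
  simp only [Function.comp_def, Finset.sum_mul_sum]
  refine integrable_finsetSum _ fun k _ => integrable_finsetSum _ fun l _ => ?_
  refine ((integrable_eval_mul_eval_gaussianPi k l).const_mul
    (c σ k * Real.sqrt v * (c τ l * Real.sqrt v))).congr (ae_of_all _ fun z => ?_)
  simp only
  ring

lemma integral_eval_mul_eval_gaussLaw (c : α → κ → ℝ) (v : ℝ≥0) (σ τ : α) :
    ∫ y, y σ * y τ ∂gaussLaw c v = v * coeffCov c σ τ := by
  classical
  rw [integral_gaussLaw c v (F := fun y => y σ * y τ) (by fun_prop)]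
  have : ∀ z : κ → ℝ, (Real.sqrt v * ∑ k, c σ k * z k) * (Real.sqrt v * ∑ k, c τ k * z k)
      = ∑ k, ∑ l, (v * (c σ k * c τ l)) * (z k * z l) := by
    intro z
    rw [mul_mul_mul_comm, Real.mul_self_sqrt v.coe_nonneg, Finset.sum_mul_sum, Finset.mul_sum]
    refine Finset.sum_congr rfl fun k _ => ?_
    rw [Finset.mul_sum]
    exact Finset.sum_congr rfl fun l _ => by ring
  simp only [this]
  rw [integral_finsetSum _ fun k _ => integrable_finsetSum _ fun l _ =>
    (integrable_eval_mul_eval_gaussianPi k l).const_mul _, coeffCov, Finset.mul_sum]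
  refine Finset.sum_congr rfl fun k _ => ?_
  rw [integral_finsetSum _ fun l _ => (integrable_eval_mul_eval_gaussianPi k l).const_mul _]
  simp [integral_const_mul, integral_eval_mul_eval_gaussianPi]

lemma integral_expAvg {Ω : Type*} [MeasurableSpace Ω] {μ : Measure Ω} (w : α → ℝ)
    {Y : Ω → α → ℝ} (hY : ∀ σ, Integrable (fun ω => Y ω σ) μ) :
    ∫ ω, expAvg S w (Y ω) ∂μ = expAvg S w fun σ => ∫ ω, Y ω σ ∂μ := by
  simp only [expAvg, integral_div]
  rw [integral_finsetSum _ fun σ _ => (hY σ).const_mul _]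
  simp only [integral_const_mul]

lemma integrable_expAvg {Ω : Type*} [MeasurableSpace Ω] {μ : Measure Ω} (w : α → ℝ)
    {Y : Ω → α → ℝ} (hY : ∀ σ, Integrable (fun ω => Y ω σ) μ) :
    Integrable (fun ω => expAvg S w (Y ω)) μ :=
  (integrable_finsetSum _ fun σ _ => (hY σ).const_mul _).div_const _

lemma expAvg_sq (w y : α → ℝ) :
    expAvg S w y ^ 2 = expAvg S w fun σ => expAvg S w fun τ => y σ * y τ := by
  simp only [expAvg_mul_left]
  have : ∀ σ, y σ * expAvg S w y = expAvg S w y * y σ := fun σ => mul_comm _ _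
  simp only [this, expAvg_mul_left, sq]

lemma integrable_logSumExp (hS : S.Nonempty) {Ω : Type*} [MeasurableSpace Ω] {μ : Measure Ω}
    [IsProbabilityMeasure μ] {Y : Ω → α → ℝ} (hm : ∀ σ, Measurable fun ω => Y ω σ)
    (hY : ∀ σ, Integrable (fun ω => Y ω σ) μ) :
    Integrable (fun ω => logSumExp S (Y ω)) μ := by
  refine Integrable.mono' (g := fun ω => Real.log S.card + ∑ σ ∈ S, |Y ω σ|)
    ((integrable_const _).add (integrable_finsetSum _ fun σ _ => (hY σ).abs))
    (measurable_logSumExp hm).aestronglyMeasurable (ae_of_all _ fun ω => ?_)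
  exact abs_logSumExp_le hS _ fun σ hσ =>
    Finset.single_le_sum (f := fun σ => |Y ω σ|) (fun _ _ => abs_nonneg _) hσ

/-- Second-order expansion of the expected `logSumExp` under a small Gaussian perturbation. -/
lemma exists_abs_integral_gaussLaw_sub_le (hS : S.Nonempty) (c : α → κ → ℝ) :
    ∃ M : ℝ, ∀ (v : ℝ≥0) (w : α → ℝ),
      |∫ y, logSumExp S (fun σ => w σ + y σ) ∂gaussLaw c v - logSumExp S w
        - v / 2 * expAvg S w (fun σ => expAvg S w fun τ => coeffCov c σ σ - coeffCov c σ τ)|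
      ≤ M * Real.sqrt v ^ 3 := by
  let B : (κ → ℝ) → ℝ := fun z => ∑ σ ∈ S, ∑ k, |c σ k| * |z k|
  have hBi : Integrable (fun z => B z ^ 3) (Measure.pi fun _ : κ => gaussianReal 0 1) := by
    have h3 : MemLp B 3 (Measure.pi fun _ : κ => gaussianReal 0 1) := by
      refine memLp_finsetSum _ fun σ _ => memLp_finsetSum _ fun k _ => ?_
      exact (by simpa using (memLp_eval_gaussianPi k 3).norm : MemLp (fun z : κ → ℝ => |z k|) 3
        (Measure.pi fun _ : κ => gaussianReal 0 1)).const_mul _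
    have := h3.integrable_norm_pow (p := 3) (by norm_num)
    refine this.congr (ae_of_all _ fun z => ?_)
    have : 0 ≤ B z := by positivity
    simp [abs_of_nonneg this]
  refine ⟨6 * ∫ z, B z ^ 3 ∂(Measure.pi fun _ : κ => gaussianReal 0 1), fun v w => ?_⟩
  let R : (α → ℝ) → ℝ := fun y => logSumExp S (fun σ => w σ + y σ) - logSumExp S w
    - expAvg S w y - (expAvg S w (fun σ => y σ ^ 2) - expAvg S w y ^ 2) / 2
  have i1 : Integrable (fun y => logSumExp S (fun σ => w σ + y σ)) (gaussLaw c v) :=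
    integrable_logSumExp hS (by fun_prop)
      fun σ => (integrable_const _).add (integrable_eval_gaussLaw c v σ)
  have i2 : Integrable (fun y => expAvg S w y) (gaussLaw c v) :=
    integrable_expAvg w (integrable_eval_gaussLaw c v)
  have i3 : ∀ σ, Integrable (fun y => y σ ^ 2) (gaussLaw c v) := fun σ => by
    simpa [sq] using integrable_eval_mul_eval_gaussLaw c v σ σ
  have i4 : ∀ σ, Integrable (fun y => expAvg S w fun τ => y σ * y τ) (gaussLaw c v) :=
    fun σ => integrable_expAvg w (integrable_eval_mul_eval_gaussLaw c v σ)
  have i5 : Integrable (fun y => expAvg S w y ^ 2) (gaussLaw c v) := by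
    simp only [expAvg_sq]
    exact integrable_expAvg w i4
  have e1 : ∫ y, R y ∂gaussLaw c v
      = ∫ y, logSumExp S (fun σ => w σ + y σ) ∂gaussLaw c v - logSumExp S w
        - v / 2 * expAvg S w (fun σ => expAvg S w fun τ => coeffCov c σ σ - coeffCov c σ τ) := by
    have i6 : Integrable (fun y => logSumExp S (fun σ => w σ + y σ) - logSumExp S w)
      (gaussLaw c v) := i1.sub (integrable_const _)
    have i7 : Integrable (fun y => logSumExp S (fun σ => w σ + y σ) - logSumExp S w
      - expAvg S w y) (gaussLaw c v) := i6.sub i2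
    have i8 : Integrable (fun y => (expAvg S w (fun σ => y σ ^ 2) - expAvg S w y ^ 2) / 2)
      (gaussLaw c v) := ((integrable_expAvg w i3).sub i5).div_const 2
    simp only [R]
    rw [integral_sub i7 i8, integral_sub i6 i2, integral_sub i1 (integrable_const _),
      integral_div, integral_sub (integrable_expAvg w i3) i5]
    simp only [expAvg_sq]
    rw [integral_expAvg w i3, integral_expAvg w (integrable_eval_gaussLaw c v),
      integral_expAvg w i4]
    have hin2 : ∀ σ, ∫ y, expAvg S w (fun τ => y σ * y τ) ∂gaussLaw c v
        = v * expAvg S w (coeffCov c σ) := by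
      intro σ
      rw [integral_expAvg w (integrable_eval_mul_eval_gaussLaw c v σ)]
      simp only [integral_eval_mul_eval_gaussLaw, expAvg_mul_left]
    simp only [hin2]
    simp only [integral_eval_mul_eval_gaussLaw, integral_eval_gaussLaw, sq, expAvg_mul_left]
    have h0 := sum_exp_pos hS w
    have hin : ∀ σ, expAvg S w (fun τ => coeffCov c σ σ - coeffCov c σ τ)
        = coeffCov c σ σ - expAvg S w (coeffCov c σ) := by
      intro σ
      simp only [expAvg, mul_sub, Finset.sum_sub_distrib, sub_div, ← Finset.sum_mul]
      rw [mul_div_cancel_left₀ _ h0.ne']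
    simp only [hin]
    have hout : expAvg S w (fun σ => coeffCov c σ σ - expAvg S w (coeffCov c σ))
        = expAvg S w (fun σ => coeffCov c σ σ)
          - expAvg S w (fun σ => expAvg S w (coeffCov c σ)) := by
      simp only [expAvg, mul_sub, Finset.sum_sub_distrib, sub_div]
    rw [hout]
    have hz : expAvg S w (fun _ => 0) = 0 := by simp [expAvg]
    simp [hz]
    ring
  have hRm : Measurable R := by
    refine Measurable.sub (Measurable.sub (Measurable.sub ?_ measurable_const) ?_) ?_
    · exact measurable_logSumExp (by fun_prop)
    · exact measurable_expAvg (by fun_prop) (by fun_prop)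
    · refine (Measurable.sub ?_ (Measurable.pow_const ?_ 2)).div_const 2
      · exact measurable_expAvg (by fun_prop) (by fun_prop)
      · exact measurable_expAvg (by fun_prop) (by fun_prop)
  rw [← e1, integral_gaussLaw c v hRm, mul_comm, mul_left_comm, ← integral_const_mul,
    ← integral_const_mul, ← Real.norm_eq_abs]
  refine norm_integral_le_of_norm_le ((hBi.const_mul (Real.sqrt v ^ 3)).const_mul 6)
    (ae_of_all _ fun z => ?_)
  have := abs_logSumExp_taylor_le hS w (fun σ => Real.sqrt v * ∑ k, c σ k * z k)
    (B := Real.sqrt v * B z) (fun σ hσ => by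
      rw [abs_mul, abs_of_nonneg (Real.sqrt_nonneg _)]
      refine mul_le_mul_of_nonneg_left ?_ (Real.sqrt_nonneg _)
      refine le_trans ?_ (Finset.single_le_sum (f := fun σ => ∑ k, |c σ k| * |z k|)
        (fun _ _ => by positivity) hσ)
      refine (Finset.abs_sum_le_sum_abs _ _).trans (le_of_eq ?_)
      simp only [abs_mul])
  refine this.trans (le_of_eq ?_)
  ring

lemma integrable_eval_conv {μ ν : Measure (α → ℝ)} [IsProbabilityMeasure μ]
    [IsProbabilityMeasure ν] (hμ : ∀ σ, Integrable (fun y => y σ) μ)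
    (hν : ∀ σ, Integrable (fun y => y σ) ν) (σ : α) :
    Integrable (fun y => y σ) (μ ∗ ν) := by
  rw [Measure.conv, integrable_map_measure (Measurable.aestronglyMeasurable (by fun_prop))
    (by fun_prop)]
  exact ((hμ σ).comp_fst ν).add ((hν σ).comp_snd μ)

lemma expAvg_mono (hS : S.Nonempty) (w : α → ℝ) {f g : α → ℝ} (h : ∀ σ ∈ S, f σ ≤ g σ) :
    expAvg S w f ≤ expAvg S w g :=
  div_le_div_of_nonneg_right
    (Finset.sum_le_sum fun σ hσ => mul_le_mul_of_nonneg_left (h σ hσ) (Real.exp_pos _).le)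
    (sum_exp_pos hS w).le

lemma expAvg_const (hS : S.Nonempty) (w : α → ℝ) (a : ℝ) : expAvg S w (fun _ => a) = a := by
  rw [expAvg, ← Finset.sum_mul, mul_div_assoc, mul_div_cancel₀]
  exact (sum_exp_pos hS w).ne'

/-- **Gaussian comparison** for the expected `logSumExp` of two centered Gaussian processes. -/
theorem integral_logSumExp_gaussLaw_le (hS : S.Nonempty) (c : α → κ → ℝ) (c' : α → κ' → ℝ)
    {K : ℝ} (hK : ∀ σ ∈ S, ∀ τ ∈ S,
      coeffCov c σ σ - coeffCov c σ τ ≤ coeffCov c' σ σ - coeffCov c' σ τ + K) :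
    ∫ y, logSumExp S y ∂gaussLaw c 1 ≤ ∫ y, logSumExp S y ∂gaussLaw c' 1 + K / 2 := by
  obtain ⟨M, hM⟩ := exists_abs_integral_gaussLaw_sub_le hS c
  obtain ⟨M', hM'⟩ := exists_abs_integral_gaussLaw_sub_le hS c'
  have hcov : ∀ w, expAvg S w (fun σ => expAvg S w fun τ => coeffCov c σ σ - coeffCov c σ τ)
      ≤ expAvg S w (fun σ => expAvg S w fun τ => coeffCov c' σ σ - coeffCov c' σ τ) + K := by
    intro w
    have hadd : ∀ f : α → ℝ, expAvg S w f + K = expAvg S w (fun σ => f σ + K) := by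
      intro f
      simp only [expAvg, mul_add, Finset.sum_add_distrib, add_div]
      congr 1
      exact (expAvg_const hS w K).symm
    rw [hadd]
    simp only [hadd]
    exact expAvg_mono hS w fun σ hσ => expAvg_mono hS w fun τ hτ => hK σ hσ τ hτ
  let E : ℝ≥0 → ℝ≥0 → ℝ := fun a s => ∫ y, logSumExp S y ∂(gaussLaw c a ∗ gaussLaw c' s)
  have step : ∀ a s ε : ℝ≥0,
      E (a + ε) s ≤ E a (s + ε) + (ε * (K / 2) + (M + M') * Real.sqrt ε ^ 3) := by
    intro a s ε
    let R := gaussLaw c a ∗ gaussLaw c' s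
    have hR : ∀ σ, Integrable (fun y => y σ) R :=
      integrable_eval_conv (integrable_eval_gaussLaw c a) (integrable_eval_gaussLaw c' s)
    have e1 : gaussLaw c (a + ε) ∗ gaussLaw c' s = R ∗ gaussLaw c ε := by
      rw [← gaussLaw_conv, Measure.conv_assoc, Measure.conv_comm (gaussLaw c ε),
        ← Measure.conv_assoc]
    have e2 : gaussLaw c a ∗ gaussLaw c' (s + ε) = R ∗ gaussLaw c' ε := by
      rw [← gaussLaw_conv, ← Measure.conv_assoc]
    have i1 : Integrable (logSumExp S) (R ∗ gaussLaw c ε) :=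
      integrable_logSumExp hS (Y := fun y => y) (by fun_prop)
        (integrable_eval_conv hR (integrable_eval_gaussLaw c ε))
    have i2 : Integrable (logSumExp S) (R ∗ gaussLaw c' ε) :=
      integrable_logSumExp hS (Y := fun y => y) (by fun_prop)
        (integrable_eval_conv hR (integrable_eval_gaussLaw c' ε))
    simp only [E]
    rw [e1, e2, integral_conv i1, integral_conv i2]
    have k1 : Integrable (fun x => ∫ y, logSumExp S (x + y) ∂gaussLaw c ε) R := by
      exact ((integrable_map_measure i1.1 (by fun_prop)).1 i1).integral_prod_left
    have k2 : Integrable (fun x => ∫ y, logSumExp S (x + y) ∂gaussLaw c' ε) R := by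
      exact ((integrable_map_measure i2.1 (by fun_prop)).1 i2).integral_prod_left
    rw [← sub_le_iff_le_add', ← integral_sub k1 k2]
    refine (integral_mono (k1.sub k2) (integrable_const
      (ε * (K / 2) + (M + M') * Real.sqrt ε ^ 3)) fun w => ?_).trans (by simp)
    have h1 := (abs_le.1 (hM ε w)).2
    have h2 := (abs_le.1 (hM' ε w)).1
    have h3 := mul_le_mul_of_nonneg_left (hcov w) (by positivity : (0 : ℝ) ≤ ε / 2)
    change ∫ y, logSumExp S (fun σ => w σ + y σ) ∂gaussLaw c ε
      - ∫ y, logSumExp S (fun σ => w σ + y σ) ∂gaussLaw c' ε ≤ _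
    linarith
  have iter : ∀ (N : ℕ) (ε a s : ℝ≥0), E (a + N * ε) s
      ≤ E a (s + N * ε) + N * (ε * (K / 2) + (M + M') * Real.sqrt ε ^ 3) := by
    intro N
    induction N with
    | zero => intro ε a s; simp
    | succ N ih =>
      intro ε a s
      have h1 := step (a + N * ε) s ε
      have h2 := ih ε a (s + ε)
      have e1 : a + N * ε + ε = a + ((N + 1 : ℕ) : ℝ≥0) * ε := by push_cast; ring
      have e2 : s + ε + N * ε = s + ((N + 1 : ℕ) : ℝ≥0) * ε := by push_cast; ring
      rw [e1] at h1
      rw [e2] at h2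
      push_cast at h1 h2 ⊢
      linarith
  have bound : ∀ N : ℕ, E 1 0 ≤ E 0 1 + (K / 2 + (M + M') * Real.sqrt (1 / ((N : ℝ) + 1))) := by
    intro N
    have h := iter (N + 1) (1 / ((N : ℝ≥0) + 1)) 0 0
    have hN : ((N + 1 : ℕ) : ℝ≥0) * (1 / ((N : ℝ≥0) + 1)) = 1 := by
      push_cast; field_simp
    simp only [hN, zero_add] at h
    refine h.trans (le_of_eq ?_)
    push_cast
    have hp : (0 : ℝ) < (N : ℝ) + 1 := by positivity
    have hs : Real.sqrt (1 / ((N : ℝ) + 1)) ^ 3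
        = Real.sqrt (1 / ((N : ℝ) + 1)) * (1 / ((N : ℝ) + 1)) := by
      rw [pow_succ', Real.sq_sqrt (by positivity)]
    rw [hs]
    field_simp
  have hlim : Tendsto (fun N : ℕ => E 0 1 + (K / 2 + (M + M') * Real.sqrt (1 / ((N : ℝ) + 1))))
      atTop (nhds (E 0 1 + (K / 2 + (M + M') * Real.sqrt 0))) :=
    (((Real.continuous_sqrt.tendsto 0).comp
      tendsto_one_div_add_atTop_nhds_zero_nat).const_mul _ |>.const_add _).const_add _
  have := ge_of_tendsto' hlim bound
  simp only [Real.sqrt_zero, mul_zero, add_zero, E, gaussLaw_zero, Measure.conv_dirac_zero,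
    Measure.dirac_zero_conv] at this
  exact this

end GaussianComparison

section Transfer

variable {α α' κ κ' : Type*} [Fintype κ] [Fintype κ'] {S : Finset α} {S' : Finset α'}

lemma integral_logSumExp_gaussLaw_eq (c : α → κ → ℝ) :
    ∫ y, logSumExp S y ∂gaussLaw c 1 = ∫ z, logSumExp S (fun σ => ∑ k, c σ k * z k)
      ∂(Measure.pi fun _ : κ => gaussianReal 0 1) := by
  rw [integral_gaussLaw c 1 (F := logSumExp S) (measurable_logSumExp (by fun_prop))]
  simp

lemma integrable_logSumExp_gaussianPi (hS : S.Nonempty) (c : α → κ → ℝ) :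
    Integrable (fun z : κ → ℝ => logSumExp S (fun σ => ∑ k, c σ k * z k))
      (Measure.pi fun _ : κ => gaussianReal 0 1) := by
  refine integrable_logSumExp hS (by fun_prop) fun σ => ?_
  refine integrable_finsetSum _ fun k _ => Integrable.const_mul ?_ _
  exact memLp_one_iff_integrable.1 (by simpa using memLp_eval_gaussianPi k 1)

/-- Gaussian comparison along an injective map of configurations. -/
lemma integral_logSumExp_gaussLaw_le_of_injOn (hS : S.Nonempty) (e : α → α')
    (he : Set.InjOn e S) (hmap : ∀ σ ∈ S, e σ ∈ S') (c : α → κ → ℝ) (c' : α' → κ' → ℝ) {K : ℝ}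
    (hK : ∀ σ ∈ S, ∀ τ ∈ S, coeffCov c σ σ - coeffCov c σ τ
      ≤ coeffCov c' (e σ) (e σ) - coeffCov c' (e σ) (e τ) + K) :
    ∫ y, logSumExp S y ∂gaussLaw c 1 ≤ ∫ y, logSumExp S' y ∂gaussLaw c' 1 + K / 2 := by
  classical
  refine (integral_logSumExp_gaussLaw_le hS c (fun σ => c' (e σ)) hK).trans ?_
  rw [add_le_add_iff_right, integral_logSumExp_gaussLaw_eq, integral_logSumExp_gaussLaw_eq]
  have hS' : S'.Nonempty := hS.elim fun σ hσ => ⟨e σ, hmap σ hσ⟩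
  refine integral_mono (integrable_logSumExp_gaussianPi hS _)
    (integrable_logSumExp_gaussianPi hS' c') fun z => ?_
  have : logSumExp S (fun σ => ∑ k, c' (e σ) k * z k)
      = logSumExp (S.image e) (fun σ => ∑ k, c' σ k * z k) := by
    rw [logSumExp, logSumExp, Finset.sum_image he]
  simp only [this]
  exact logSumExp_mono (hS.image e) (Finset.image_subset_iff.2 hmap) _

/-- The expected `logSumExp` of two independent systems is additive. -/
lemma integral_logSumExp_gaussLaw_product (hS : S.Nonempty) (hS' : S'.Nonempty)
    (c : α → κ → ℝ) (c' : α' → κ' → ℝ) :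
    ∫ y, logSumExp (S ×ˢ S') y ∂gaussLaw (fun p : α × α' => Sum.elim (c p.1) (c' p.2)) 1
      = ∫ y, logSumExp S y ∂gaussLaw c 1 + ∫ y, logSumExp S' y ∂gaussLaw c' 1 := by
  rw [integral_logSumExp_gaussLaw_eq, integral_logSumExp_gaussLaw_eq,
    integral_logSumExp_gaussLaw_eq]
  have hmp := measurePreserving_sumPiEquivProdPi (X := fun _ : κ ⊕ κ' => ℝ)
    (fun _ => gaussianReal 0 1)
  have hlog : ∀ z : κ ⊕ κ' → ℝ,
      logSumExp (S ×ˢ S') (fun p : α × α' => ∑ k, Sum.elim (c p.1) (c' p.2) k * z k)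
      = logSumExp S (fun σ => ∑ k, c σ k * z (Sum.inl k))
        + logSumExp S' (fun σ => ∑ k, c' σ k * z (Sum.inr k)) := by
    intro z
    simp only [logSumExp, Fintype.sum_sum_type, Sum.elim_inl, Sum.elim_inr, Real.exp_add]
    rw [← Real.log_mul (sum_exp_pos hS _).ne' (sum_exp_pos hS' _).ne', Finset.sum_mul_sum,
      Finset.sum_product]
  simp only [hlog]
  have i1 := (integrable_logSumExp_gaussianPi hS c).comp_fst
    (Measure.pi fun _ : κ' => gaussianReal 0 1)
  have i2 := (integrable_logSumExp_gaussianPi hS' c').comp_snd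
    (Measure.pi fun _ : κ => gaussianReal 0 1)
  have := hmp.integral_comp (MeasurableEquiv.measurableEmbedding _)
    (fun p : (κ → ℝ) × (κ' → ℝ) => logSumExp S (fun σ => ∑ k, c σ k * p.1 k)
        + logSumExp S' (fun σ => ∑ k, c' σ k * p.2 k))
  refine this.trans ?_
  rw [integral_add i1 i2]
  congr 1
  · exact (integral_fun_fst (fun z : κ → ℝ =>
      logSumExp S (fun σ => ∑ k, c σ k * z k))).trans (by simp)
  · exact (integral_fun_snd (fun z : κ' → ℝ =>
      logSumExp S' (fun σ => ∑ k, c' σ k * z k))).trans (by simp)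

lemma coeffCov_product (c : α → κ → ℝ) (c' : α' → κ' → ℝ) (p q : α × α') :
    coeffCov (fun p : α × α' => Sum.elim (c p.1) (c' p.2)) p q
      = coeffCov c p.1 q.1 + coeffCov c' p.2 q.2 := by
  simp [coeffCov]

end Transfer

section Bisection

open scoped Classical in
/-- The finite set of bisections. -/
noncomputable def bisections (n : ℕ) : Finset (Fin n → Bool) :=
  Finset.univ.filter isBis

lemma mem_bisections {n : ℕ} {σ : Fin n → Bool} :
    σ ∈ bisections n ↔ |∑ i, spin (σ i)| ≤ 1 := by
  simp [bisections, isBis]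

lemma spin_mul_self (b : Bool) : spin b * spin b = 1 := by
  cases b <;> simp [spin]

lemma abs_spin (b : Bool) : |spin b| = 1 := by
  cases b <;> simp [spin]

lemma spin_injective : Function.Injective spin := by
  intro a b
  cases a <;> cases b <;> norm_num [spin]

lemma exists_sum_spin_eq {n : ℕ} (σ : Fin n → Bool) :
    ∃ k : ℤ, ∑ i, spin (σ i) = ((2 * k - n : ℤ) : ℝ) := by
  refine ⟨∑ i, if σ i then 1 else 0, ?_⟩
  push_cast
  have hn : (n : ℝ) = ∑ _i : Fin n, (1 : ℝ) := by simp
  rw [Finset.mul_sum, hn, ← Finset.sum_sub_distrib]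
  refine Finset.sum_congr rfl fun i _ => ?_
  cases h : σ i <;> norm_num [spin, h]

lemma sum_spin_eq_zero_of_even {n : ℕ} (hn : Even n) {σ : Fin n → Bool}
    (hσ : σ ∈ bisections n) : ∑ i, spin (σ i) = 0 := by
  rw [mem_bisections] at hσ
  obtain ⟨k, hk⟩ := exists_sum_spin_eq σ
  obtain ⟨m, hm⟩ := hn
  rw [hk] at hσ ⊢
  have h : |2 * k - (n : ℤ)| ≤ 1 := by exact_mod_cast hσ
  have : 2 * k - (n : ℤ) = 0 := by rw [abs_le] at h; omega
  exact_mod_cast this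

lemma sum_spin_of_odd {n : ℕ} (hn : Odd n) {σ : Fin n → Bool}
    (hσ : σ ∈ bisections n) : ∑ i, spin (σ i) = 1 ∨ ∑ i, spin (σ i) = -1 := by
  rw [mem_bisections] at hσ
  obtain ⟨k, hk⟩ := exists_sum_spin_eq σ
  obtain ⟨m, hm⟩ := hn
  rw [hk] at hσ ⊢
  have h : |2 * k - (n : ℤ)| ≤ 1 := by exact_mod_cast hσ
  have : 2 * k - (n : ℤ) = 1 ∨ 2 * k - (n : ℤ) = -1 := by rw [abs_le] at h; omega
  exact_mod_cast this

lemma bisections_nonempty (n : ℕ) : (bisections n).Nonempty := by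
  refine ⟨fun i => decide (Even (i : ℕ)), mem_bisections.2 ?_⟩
  have : ∀ m : ℕ, ∑ i : Fin m, spin (decide (Even (i : ℕ))) = if Even m then 0 else 1 := by
    intro m
    induction m with
    | zero => simp
    | succ m ih =>
      rw [Fin.sum_univ_castSucc]
      simp only [Fin.val_castSucc, ih, Fin.val_last, Nat.even_add_one]
      by_cases h : Even m <;> simp [h, spin]
  rw [this]
  split_ifs <;> simp

/-- Coefficients of `-β H_SK` on standard Gaussians. -/
noncomputable def skCoeff (n : ℕ) (β : ℝ) (σ : Fin n → Bool) (p : Fin n × Fin n) : ℝ :=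
  -β * Real.sqrt (1 / (2 * n)) * (spin (σ p.1) * spin (σ p.2))

/-- The expected log-partition function of the bisection SK model. -/
noncomputable def skFree (n : ℕ) (β : ℝ) : ℝ :=
  ∫ y, logSumExp (bisections n) y ∂gaussLaw (skCoeff n β) 1

lemma coeffCov_skCoeff (n : ℕ) (β : ℝ) (σ τ : Fin n → Bool) :
    coeffCov (skCoeff n β) σ τ = β ^ 2 / (2 * n) * (∑ i, spin (σ i) * spin (τ i)) ^ 2 := by
  have hs : Real.sqrt (1 / (2 * n)) * Real.sqrt (1 / (2 * n)) = 1 / (2 * n) :=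
    Real.mul_self_sqrt (by positivity)
  have : ∀ p : Fin n × Fin n, skCoeff n β σ p * skCoeff n β τ p
      = β ^ 2 / (2 * n) * ((spin (σ p.1) * spin (τ p.1)) * (spin (σ p.2) * spin (τ p.2))) := by
    intro p
    rw [show skCoeff n β σ p * skCoeff n β τ p = β ^ 2
      * (Real.sqrt (1 / (2 * n)) * Real.sqrt (1 / (2 * n)))
      * ((spin (σ p.1) * spin (τ p.1)) * (spin (σ p.2) * spin (τ p.2))) by
        simp only [skCoeff]; ring, hs]
    ring
  simp only [coeffCov, this]
  rw [← Finset.mul_sum, Fintype.sum_prod_type, sq (∑ i, spin (σ i) * spin (τ i)),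
    Finset.sum_mul_sum]

lemma coeffCov_skCoeff_self (n : ℕ) (β : ℝ) (σ : Fin n → Bool) :
    coeffCov (skCoeff n β) σ σ = β ^ 2 / 2 * n := by
  rw [coeffCov_skCoeff]
  simp only [spin_mul_self]
  rcases eq_or_ne n 0 with rfl | h
  · simp
  · simp; field_simp

lemma abs_sum_spin_mul_spin_le {n : ℕ} (σ τ : Fin n → Bool) :
    |∑ i, spin (σ i) * spin (τ i)| ≤ n := by
  refine (Finset.abs_sum_le_sum_abs _ _).trans ?_
  simp [abs_mul, abs_spin]

lemma skFree_le (n : ℕ) (β : ℝ) : skFree n β ≤ (Real.log 2 + β ^ 2 / 4) * n := by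
  have h := integral_logSumExp_gaussLaw_le (bisections_nonempty n) (skCoeff n β)
    (fun _ (_ : Fin 0) => (0 : ℝ)) (K := β ^ 2 / 2 * n) (fun σ _ τ _ => by
      rw [coeffCov_skCoeff_self, coeffCov_skCoeff]
      simp only [coeffCov]
      have : 0 ≤ β ^ 2 / (2 * n) * (∑ i, spin (σ i) * spin (τ i)) ^ 2 := by positivity
      simp
      linarith)
  rw [integral_logSumExp_gaussLaw_eq (fun _ (_ : Fin 0) => (0 : ℝ))] at h
  have hl : logSumExp (bisections n) (fun _ => 0) ≤ Real.log 2 * n := by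
    have : ((bisections n).card : ℝ) ≤ 2 ^ n := by
      exact_mod_cast (Finset.card_le_univ _).trans (by simp)
    simp only [logSumExp, Real.exp_zero, Finset.sum_const, nsmul_eq_mul, mul_one]
    refine (Real.log_le_log (by exact_mod_cast (bisections_nonempty n).card_pos) this).trans ?_
    rw [Real.log_pow, mul_comm]
  simp only [Finset.univ_eq_empty, Finset.sum_empty, integral_const, probReal_univ,
    one_smul] at h
  rw [skFree]
  linarith

lemma skFree_add_le {n m : ℕ} (hn : Even n) (hm : Even m) (β₁ β₂ β : ℝ) {K : ℝ}
    (hK : ∀ a b : ℝ, |a| ≤ n → |b| ≤ m →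
      (β₁ ^ 2 / 2 * n - β₁ ^ 2 / (2 * n) * a ^ 2) + (β₂ ^ 2 / 2 * m - β₂ ^ 2 / (2 * m) * b ^ 2)
      ≤ β ^ 2 / 2 * (n + m) - β ^ 2 / (2 * (n + m)) * (a + b) ^ 2 + K) :
    skFree n β₁ + skFree m β₂ ≤ skFree (n + m) β + K / 2 := by
  rw [skFree, skFree, ← integral_logSumExp_gaussLaw_product (bisections_nonempty n)
    (bisections_nonempty m)]
  refine integral_logSumExp_gaussLaw_le_of_injOn
    ((bisections_nonempty n).product (bisections_nonempty m))
    (fun p => Fin.append p.1 p.2) ?_ ?_ _ _ ?_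
  · rintro ⟨a, b⟩ - ⟨a', b'⟩ - h
    have h1 : a = a' := by
      ext i; simpa using congrFun h (Fin.castAdd m i)
    have h2 : b = b' := by
      ext i; simpa using congrFun h (Fin.natAdd n i)
    rw [h1, h2]
  · rintro ⟨a, b⟩ h
    rw [Finset.mem_product] at h
    rw [mem_bisections, Fin.sum_univ_add]
    simp [sum_spin_eq_zero_of_even hn h.1, sum_spin_eq_zero_of_even hm h.2]
  · rintro ⟨a, b⟩ - ⟨a', b'⟩ -
    have := hK _ _ (abs_sum_spin_mul_spin_le a a') (abs_sum_spin_mul_spin_le b b')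
    simp only [coeffCov_product, coeffCov_skCoeff_self]
    simp only [coeffCov_skCoeff, Fin.sum_univ_add, Fin.append_left, Fin.append_right]
    push_cast
    linarith

lemma skFree_superadditive {n m : ℕ} (hn : Even n) (hm : Even m) (β : ℝ) :
    skFree n β + skFree m β ≤ skFree (n + m) β := by
  have := skFree_add_le hn hm β β β (K := 0) (fun a b ha hb => by
    rcases eq_or_ne n 0 with rfl | hn0
    · have : a = 0 := by simpa using ha
      simp [this]
    rcases eq_or_ne m 0 with rfl | hm0
    · have : b = 0 := by simpa using hb
      simp [this]
    have hn' : (0 : ℝ) < n := by positivity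
    have hm' : (0 : ℝ) < m := by positivity
    have key : (a + b) ^ 2 / (n + m) ≤ a ^ 2 / n + b ^ 2 / m := by
      rw [div_add_div _ _ hn'.ne' hm'.ne', div_le_div_iff₀ (by positivity) (by positivity)]
      nlinarith [sq_nonneg (a * m - b * n)]
    have h2 := mul_le_mul_of_nonneg_left key (by positivity : 0 ≤ β ^ 2 / 2)
    have e1 : β ^ 2 / (2 * n) * a ^ 2 = β ^ 2 / 2 * (a ^ 2 / n) := by field_simp
    have e2 : β ^ 2 / (2 * m) * b ^ 2 = β ^ 2 / 2 * (b ^ 2 / m) := by field_simp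
    have e3 : β ^ 2 / (2 * (n + m)) * (a + b) ^ 2 = β ^ 2 / 2 * ((a + b) ^ 2 / (n + m)) := by
      field_simp
    rw [e1, e2, e3]
    linarith)
  simpa using this

lemma skFree_semiconcave {n : ℕ} (hn : Even n) (β δ : ℝ) :
    skFree n (β + δ) + skFree n (β - δ) ≤ skFree (n + n) β + 5 / 2 * δ ^ 2 * n := by
  have := skFree_add_le hn hn (β + δ) (β - δ) β (K := 5 * δ ^ 2 * n) (fun a b ha hb => by
    rcases eq_or_ne n 0 with rfl | hn0
    · have h1 : a = 0 := by simpa using ha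
      have h2 : b = 0 := by simpa using hb
      simp [h1, h2]
    have hn' : (0 : ℝ) < n := by positivity
    have ha2 : a ^ 2 ≤ (n : ℝ) ^ 2 := sq_le_sq' (abs_le.1 ha).1 (abs_le.1 ha).2
    have hb2 : b ^ 2 ≤ (n : ℝ) ^ 2 := sq_le_sq' (abs_le.1 hb).1 (abs_le.1 hb).2
    have key : β ^ 2 * (a + b) ^ 2 ≤ 2 * (β + δ) ^ 2 * a ^ 2 + 2 * (β - δ) ^ 2 * b ^ 2
        + 16 * δ ^ 2 * n ^ 2 := by
      have h1 : 0 ≤ (β * (a - b) + 2 * δ * (a + b)) ^ 2 := sq_nonneg _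
      have h2 : δ ^ 2 * (a + b) ^ 2 ≤ δ ^ 2 * (4 * n ^ 2) :=
        mul_le_mul_of_nonneg_left (by nlinarith [sq_nonneg (a - b)]) (sq_nonneg _)
      nlinarith [mul_nonneg (sq_nonneg δ) (sq_nonneg a), mul_nonneg (sq_nonneg δ) (sq_nonneg b)]
    have h3 := div_le_div_of_nonneg_right key (by positivity : (0 : ℝ) ≤ 4 * n)
    have e1 : (β + δ) ^ 2 / (2 * n) * a ^ 2 + (β - δ) ^ 2 / (2 * n) * b ^ 2
        = (2 * (β + δ) ^ 2 * a ^ 2 + 2 * (β - δ) ^ 2 * b ^ 2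
        + 16 * δ ^ 2 * n ^ 2) / (4 * n) - 4 * δ ^ 2 * n := by field_simp; ring
    have e3 : β ^ 2 / (2 * (n + n)) * (a + b) ^ 2 = β ^ 2 * (a + b) ^ 2 / (4 * n) := by
      field_simp; ring
    rw [e3]
    nlinarith [e1, h3])
  linarith

lemma abs_cov_succ_sub_le {n u e : ℝ} (hn : 0 < n) (hu : |u| ≤ n) (he : e ^ 2 = 1) (β : ℝ) :
    |β ^ 2 / (2 * (n + 1)) * (u + e) ^ 2 - β ^ 2 / (2 * n) * u ^ 2| ≤ 3 / 2 * β ^ 2 := by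
  have e1 : β ^ 2 / (2 * (n + 1)) * (u + e) ^ 2 - β ^ 2 / (2 * n) * u ^ 2
      = β ^ 2 * ((2 * n * (u * e) + n * e ^ 2 - u ^ 2) / (2 * n * (n + 1))) := by
    field_simp; ring
  have hue : |u * e| ≤ n := by
    have : |e| = 1 := by
      rw [← sq_abs] at he
      nlinarith [abs_nonneg e]
    rw [abs_mul, this, mul_one]; exact hu
  have hu2 : u ^ 2 ≤ n ^ 2 := sq_le_sq' (abs_le.1 hu).1 (abs_le.1 hu).2
  rw [e1, abs_mul, abs_of_nonneg (sq_nonneg β), mul_comm (3 / 2 : ℝ)]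
  refine mul_le_mul_of_nonneg_left ?_ (sq_nonneg β)
  rw [abs_div, abs_of_pos (by positivity : 0 < 2 * n * (n + 1)), div_le_iff₀ (by positivity), he,
    abs_le]
  rw [abs_le] at hue
  constructor <;> nlinarith [sq_nonneg u, hue.1, hue.2]

lemma skFree_le_succ {n : ℕ} (hn : Odd n) (β : ℝ) :
    skFree n β ≤ skFree (n + 1) β + 3 / 2 * β ^ 2 := by
  have hn0 : (0 : ℝ) < n := by exact_mod_cast hn.pos
  have := integral_logSumExp_gaussLaw_le_of_injOn (S' := bisections (n + 1))
    (bisections_nonempty n)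
    (fun σ => (Fin.snoc σ (decide (∑ i, spin (σ i) = -1)) : Fin (n + 1) → Bool))
    (fun σ _ τ _ h => by
      ext i
      simpa using congrFun h (Fin.castSucc i)) (fun σ hσ => by
      rw [mem_bisections, Fin.sum_univ_castSucc]
      simp only [Fin.snoc_castSucc, Fin.snoc_last]
      rcases sum_spin_of_odd hn hσ with h | h <;> rw [h] <;> norm_num [spin]) (skCoeff n β)
    (skCoeff (n + 1) β) (K := 3 * β ^ 2) (fun σ _ τ _ => by
      rw [coeffCov_skCoeff_self, coeffCov_skCoeff_self, coeffCov_skCoeff, coeffCov_skCoeff,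
        Fin.sum_univ_castSucc]
      simp only [Fin.snoc_castSucc, Fin.snoc_last]
      have := abs_le.1 (abs_cov_succ_sub_le hn0 (abs_sum_spin_mul_spin_le σ τ)
        (e := spin (decide (∑ i, spin (σ i) = -1)) * spin (decide (∑ i, spin (τ i) = -1)))
        (by rw [mul_pow, sq, sq, spin_mul_self, spin_mul_self, one_mul]) β)
      push_cast
      linarith [this.2, sq_nonneg β])
  rw [skFree, skFree]
  linarith

lemma skFree_succ_le {n : ℕ} (hn : Odd n) (β : ℝ) :
    skFree (n + 1) β ≤ skFree n β + 3 / 2 * β ^ 2 := by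
  have hn0 : (0 : ℝ) < n := by exact_mod_cast hn.pos
  have hsum : ∀ σ ∈ bisections (n + 1), spin (σ (Fin.last n)) =
      -∑ i : Fin n, spin (σ i.castSucc) := by
    intro σ hσ
    have := sum_spin_eq_zero_of_even hn.add_one hσ
    rw [Fin.sum_univ_castSucc] at this
    linarith
  have := integral_logSumExp_gaussLaw_le_of_injOn (S' := bisections n)
    (bisections_nonempty (n + 1)) (fun σ (i : Fin n) => σ i.castSucc) (fun σ hσ τ hτ h => by
      have hc : ∀ i : Fin n, σ i.castSucc = τ i.castSucc := congrFun h
      have hl : σ (Fin.last n) = τ (Fin.last n) := by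
        apply spin_injective
        simp only [hsum σ hσ, hsum τ hτ, hc]
      exact funext (Fin.lastCases hl hc)) (fun σ hσ => by
      rw [mem_bisections, ← abs_neg, ← hsum σ hσ, abs_spin]) (skCoeff (n + 1) β)
    (skCoeff n β) (K := 3 * β ^ 2) (fun σ _ τ _ => by
      rw [coeffCov_skCoeff_self, coeffCov_skCoeff_self, coeffCov_skCoeff, coeffCov_skCoeff,
        Fin.sum_univ_castSucc]
      have := abs_le.1 (abs_cov_succ_sub_le hn0
        (abs_sum_spin_mul_spin_le (fun i : Fin n => σ i.castSucc) fun i => τ i.castSucc)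
        (e := spin (σ (Fin.last n)) * spin (τ (Fin.last n)))
        (by rw [mul_pow, sq, sq, spin_mul_self, spin_mul_self, one_mul]) β)
      push_cast
      linarith [this.1, sq_nonneg β])
  rw [skFree, skFree]
  linarith

lemma exists_tendsto_skFree_even (β : ℝ) :
    ∃ L, Tendsto (fun k : ℕ => skFree (k + k) β / k) atTop (nhds L) := by
  have hsub : Subadditive fun k : ℕ => -skFree (k + k) β := by
    intro k l
    have := skFree_superadditive (Even.add_self k) (Even.add_self l) β
    rw [add_add_add_comm] at this
    linarith
  have hb : BddBelow (Set.range fun k : ℕ => -skFree (k + k) β / k) := by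
    refine ⟨-(2 * (Real.log 2 + β ^ 2 / 4)), ?_⟩
    rintro _ ⟨k, rfl⟩
    have hl : 0 ≤ Real.log 2 := Real.log_nonneg (by norm_num)
    rcases eq_or_ne k 0 with rfl | hk
    · simp; positivity
    · have hk' : (0 : ℝ) < k := by positivity
      simp only
      rw [neg_div, neg_le_neg_iff, div_le_iff₀ hk']
      have := skFree_le (k + k) β
      push_cast at this
      linarith
  refine ⟨-hsub.lim, ((hsub.tendsto_lim hb).neg).congr fun k => ?_⟩
  ring

/-- Asymptotic semiconcavity of the SK free energy in the inverse temperature. -/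
lemma eventually_skFree_second_difference_le (β δ : ℝ) {ε : ℝ} (hε : 0 < ε) :
    ∀ᶠ n : ℕ in atTop, skFree n (β + δ) + skFree n (β - δ) - 2 * skFree n β
      ≤ (5 / 2 * δ ^ 2 + ε) * n := by
  obtain ⟨L, hL⟩ := exists_tendsto_skFree_even β
  let C := 3 / 2 * (β + δ) ^ 2 + 3 / 2 * (β - δ) ^ 2 + 3 * β ^ 2
  have h1 : Tendsto (fun k : ℕ => skFree ((k + k) + (k + k)) β / ((k + k : ℕ) : ℝ)
      - skFree (k + k) β / k) atTop (nhds (L - L)) :=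
    (hL.comp (tendsto_id.atTop_add_atTop tendsto_id)).sub hL
  rw [sub_self] at h1
  have hev : ∀ᶠ k : ℕ in atTop, skFree (k + k) (β + δ) + skFree (k + k) (β - δ)
      - 2 * skFree (k + k) β ≤ (5 / 2 * δ ^ 2 + ε / 2) * ((k + k : ℕ) : ℝ) := by
    filter_upwards [h1.eventually_le_const (half_pos hε), eventually_gt_atTop 0] with k hk hk0
    have hk' : (0 : ℝ) < k := by positivity
    have h2 := skFree_semiconcave (Even.add_self k) β δ
    push_cast at hk h2 ⊢
    have h3 := mul_le_mul_of_nonneg_right hk (by positivity : (0 : ℝ) ≤ k + k)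
    have e : (skFree (k + k + (k + k)) β / (k + k) - skFree (k + k) β / k) * ((k : ℝ) + k)
        = skFree (k + k + (k + k)) β - 2 * skFree (k + k) β := by
      field_simp; ring
    rw [e] at h3
    linarith
  obtain ⟨k₀, hk₀⟩ := eventually_atTop.1 hev
  obtain ⟨N, hN⟩ := exists_nat_ge ((5 / 2 * δ ^ 2 + ε + C) / (ε / 2))
  filter_upwards [eventually_ge_atTop (2 * k₀), eventually_ge_atTop N] with n hn hnN
  have hnN' : (5 / 2 * δ ^ 2 + ε + C) ≤ ε / 2 * n := by
    rw [div_le_iff₀ (by positivity)] at hN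
    have : (N : ℝ) ≤ n := by exact_mod_cast hnN
    nlinarith
  have hC : 0 ≤ C := by positivity
  rcases Nat.even_or_odd n with ⟨k, rfl⟩ | ho
  · have := hk₀ k (by omega)
    have hp : 0 ≤ ε / 2 * ((k + k : ℕ) : ℝ) := by positivity
    linarith
  · obtain ⟨k, hk⟩ := ho.add_one
    have := hk₀ k (by omega)
    rw [← hk] at this
    have a1 := skFree_le_succ ho (β + δ)
    have a2 := skFree_le_succ ho (β - δ)
    have a3 := skFree_succ_le ho β
    push_cast at this
    simp only [C] at hnN'
    nlinarith

end Bisection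

section Lindeberg

open scoped ENNReal

variable {α : Type*} {S : Finset α}

/-- Second-order expansion of `logSumExp` averaged over one centered random coordinate. -/
lemma abs_integral_logSumExp_sub_le (hS : S.Nonempty) {ν : Measure ℝ} [IsProbabilityMeasure ν]
    {v : ℝ} (h3 : MemLp (fun y : ℝ => y) 3 ν) (hmean : ∫ y, y ∂ν = 0) (hvar : ∫ y, y ^ 2 ∂ν = v)
    (w s : α → ℝ) (hs : ∀ σ ∈ S, |s σ| ≤ 1) :
    |∫ y, logSumExp S (fun σ => w σ + s σ * y) ∂ν
      - (logSumExp S w + v * ((expAvg S w (fun σ => s σ ^ 2) - expAvg S w s ^ 2) / 2))|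
      ≤ 6 * ∫ y, |y| ^ 3 ∂ν := by
  have hi1 : Integrable (fun y : ℝ => y) ν := h3.integrable (by norm_num)
  have hi2 : Integrable (fun y : ℝ => y ^ 2) ν :=
    (h3.mono_exponent (p := 2) (by norm_num)).integrable_sq
  have hi3 : Integrable (fun y : ℝ => |y| ^ 3) ν := h3.integrable_norm_pow (by norm_num)
  have il : Integrable (fun y : ℝ => logSumExp S (fun σ => w σ + s σ * y)) ν :=
    integrable_logSumExp hS (by fun_prop)
      fun σ => (integrable_const _).add (hi1.const_mul _)
  have ir : Integrable (fun y : ℝ => logSumExp S w + expAvg S w s * y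
      + y ^ 2 * ((expAvg S w (fun σ => s σ ^ 2) - expAvg S w s ^ 2) / 2)) ν :=
    ((integrable_const _).add (hi1.const_mul _)).add (hi2.mul_const _)
  have e : ∫ y, (logSumExp S w + expAvg S w s * y
      + y ^ 2 * ((expAvg S w (fun σ => s σ ^ 2) - expAvg S w s ^ 2) / 2)) ∂ν
      = logSumExp S w + v * ((expAvg S w (fun σ => s σ ^ 2) - expAvg S w s ^ 2) / 2) := by
    have i1 : Integrable (fun y : ℝ => logSumExp S w + expAvg S w s * y) ν :=
      (integrable_const _).add (hi1.const_mul _)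
    rw [integral_add i1 (hi2.mul_const _), integral_add (integrable_const _) (hi1.const_mul _),
      integral_const_mul, integral_mul_const, hmean, hvar]
    simp
  rw [← e, ← integral_sub il ir, ← integral_const_mul, ← Real.norm_eq_abs]
  refine norm_integral_le_of_norm_le (hi3.const_mul 6) (ae_of_all _ fun y => ?_)
  have h := abs_logSumExp_taylor_le hS w (fun σ => s σ * y) (B := |y|) (fun σ hσ => by
    rw [abs_mul]
    exact mul_le_of_le_one_left (abs_nonneg _) (hs σ hσ))
  have e1 : expAvg S w (fun σ => s σ * y) = expAvg S w s * y := by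
    simp only [mul_comm _ y, expAvg_mul_left]
  have e2 : expAvg S w (fun σ => (s σ * y) ^ 2) = y ^ 2 * expAvg S w (fun σ => s σ ^ 2) := by
    simp only [mul_pow, mul_comm _ (y ^ 2), expAvg_mul_left]
  rw [e1, e2] at h
  refine le_trans (le_of_eq ?_) h
  rw [Real.norm_eq_abs]
  congr 1
  ring

lemma measurable_update_prod {ι : Type*} [DecidableEq ι] (a : ι) :
    Measurable fun p : (ι → ℝ) × ℝ => Function.update p.1 a p.2 := by
  refine measurable_pi_lambda _ fun i => ?_
  rcases eq_or_ne i a with rfl | h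
  · simpa using measurable_snd
  · simp only [Function.update_of_ne h]
    fun_prop

variable {ι : Type*} [Fintype ι] [DecidableEq ι]

lemma map_update_prod_pi (ρ : ι → Measure ℝ) [∀ i, IsProbabilityMeasure (ρ i)] (a : ι)
    (ν : Measure ℝ) [IsProbabilityMeasure ν] [∀ i, IsProbabilityMeasure (Function.update ρ a ν i)] :
    ((Measure.pi ρ).prod ν).map (fun p => Function.update p.1 a p.2)
      = Measure.pi (Function.update ρ a ν) := by
  symm
  refine Measure.pi_eq fun t ht => ?_
  have hm := measurable_update_prod a
  rw [Measure.map_apply hm (MeasurableSet.univ_pi ht)]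
  have hset : (fun p : (ι → ℝ) × ℝ => Function.update p.1 a p.2) ⁻¹' Set.univ.pi t
      = (Set.univ.pi (Function.update t a Set.univ)) ×ˢ t a := by
    ext ⟨x, y⟩
    simp only [Set.mem_preimage, Set.mem_univ_pi, Set.mem_prod]
    constructor
    · intro h
      refine ⟨fun i => ?_, by simpa using h a⟩
      rcases eq_or_ne i a with rfl | hi
      · simp
      · simpa [hi] using h i
    · rintro ⟨h1, h2⟩ i
      rcases eq_or_ne i a with rfl | hi
      · simpa using h2
      · simpa [hi] using h1 i
  rw [hset, Measure.prod_prod, Measure.pi_pi, ← Finset.mul_prod_erase _ _ (Finset.mem_univ a),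
    ← Finset.mul_prod_erase _ _ (Finset.mem_univ a)]
  simp only [Function.update_self, measure_univ, one_mul]
  rw [mul_comm]
  congr 1
  refine Finset.prod_congr rfl fun i hi => ?_
  rw [Function.update_of_ne (Finset.ne_of_mem_erase hi),
    Function.update_of_ne (Finset.ne_of_mem_erase hi)]

/-- The effect on the expected `logSumExp` of replacing the law of one coordinate. -/
lemma abs_integral_logSumExp_update_sub_le (hS : S.Nonempty) (s : α → ι → ℝ)
    (hs : ∀ σ ∈ S, ∀ i, |s σ i| ≤ 1) (ρ : ι → Measure ℝ) [∀ i, IsProbabilityMeasure (ρ i)]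
    (hρ : ∀ i, Integrable (fun y : ℝ => y) (ρ i)) (a : ι)
    {ν ν' : Measure ℝ} [IsProbabilityMeasure ν] [IsProbabilityMeasure ν'] {v : ℝ}
    (h3 : MemLp (fun y : ℝ => y) 3 ν) (hmean : ∫ y, y ∂ν = 0) (hvar : ∫ y, y ^ 2 ∂ν = v)
    (h3' : MemLp (fun y : ℝ => y) 3 ν') (hmean' : ∫ y, y ∂ν' = 0) (hvar' : ∫ y, y ^ 2 ∂ν' = v) :
    |∫ x, logSumExp S (fun σ => ∑ i, s σ i * x i) ∂(Measure.pi (Function.update ρ a ν))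
      - ∫ x, logSumExp S (fun σ => ∑ i, s σ i * x i) ∂(Measure.pi (Function.update ρ a ν'))|
      ≤ 6 * (∫ y, |y| ^ 3 ∂ν + ∫ y, |y| ^ 3 ∂ν') := by
  have hm := measurable_update_prod a
  have hlin : ∀ (σ : α) (x : ι → ℝ) (y : ℝ), ∑ i, s σ i * Function.update x a y i
      = ∑ i ∈ Finset.univ.erase a, s σ i * x i + s σ a * y := by
    intro σ x y
    rw [← Finset.sum_erase_add _ _ (Finset.mem_univ a), Function.update_self]
    congr 1
    exact Finset.sum_congr rfl fun i hi => by
      rw [Function.update_of_ne (Finset.ne_of_mem_erase hi)]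
  have key : ∀ (η : Measure ℝ) [IsProbabilityMeasure η], Integrable (fun y : ℝ => y) η →
      Integrable (fun p : (ι → ℝ) × ℝ => logSumExp S
        (fun σ => ∑ i ∈ Finset.univ.erase a, s σ i * p.1 i + s σ a * p.2))
        ((Measure.pi ρ).prod η) ∧
      ∫ x, logSumExp S (fun σ => ∑ i, s σ i * x i) ∂(Measure.pi (Function.update ρ a η))
        = ∫ x, ∫ y, logSumExp S
          (fun σ => ∑ i ∈ Finset.univ.erase a, s σ i * x i + s σ a * y) ∂η ∂(Measure.pi ρ) := by
    intro η _ hη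
    have hi : Integrable (fun p : (ι → ℝ) × ℝ => logSumExp S
        (fun σ => ∑ i ∈ Finset.univ.erase a, s σ i * p.1 i + s σ a * p.2))
        ((Measure.pi ρ).prod η) := by
      refine integrable_logSumExp hS (by fun_prop) fun σ => Integrable.add ?_ ?_
      · refine integrable_finsetSum _ fun i _ => Integrable.const_mul ?_ _
        exact (integrable_comp_eval (μ := ρ) (f := fun y : ℝ => y) (hρ i)).comp_fst η
      · exact (hη.comp_snd _).const_mul _
    refine ⟨hi, ?_⟩
    have : ∀ i, IsProbabilityMeasure (Function.update ρ a η i) := by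
      intro i
      rcases eq_or_ne i a with rfl | h
      · rw [Function.update_self]; infer_instance
      · rw [Function.update_of_ne h]; infer_instance
    rw [← map_update_prod_pi, integral_map hm.aemeasurable
      (measurable_logSumExp (by fun_prop)).aestronglyMeasurable]
    simp only [hlin]
    exact integral_prod _ hi
  obtain ⟨k1, e1⟩ := key ν (h3.integrable (by norm_num))
  obtain ⟨k2, e2⟩ := key ν' (h3'.integrable (by norm_num))
  rw [e1, e2, ← integral_sub k1.integral_prod_left k2.integral_prod_left, ← Real.norm_eq_abs]
  refine (norm_integral_le_of_norm_le_const (ae_of_all _ fun x => ?_)).trans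
    (le_of_eq (by rw [probReal_univ, mul_one]))
  have b1 := abs_le.1 (abs_integral_logSumExp_sub_le hS h3 hmean hvar
    (fun σ => ∑ i ∈ Finset.univ.erase a, s σ i * x i) (fun σ => s σ a) (fun σ hσ => hs σ hσ a))
  have b2 := abs_le.1 (abs_integral_logSumExp_sub_le hS h3' hmean' hvar'
    (fun σ => ∑ i ∈ Finset.univ.erase a, s σ i * x i) (fun σ => s σ a) (fun σ hσ => hs σ hσ a))
  rw [Real.norm_eq_abs, abs_le]
  constructor <;> linarith [b1.1, b1.2, b2.1, b2.2]

/-- **Lindeberg replacement** for the expected `logSumExp` of linear functions of i.i.d. data. -/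
theorem abs_integral_logSumExp_pi_sub_le (hS : S.Nonempty) (s : α → ι → ℝ)
    (hs : ∀ σ ∈ S, ∀ i, |s σ i| ≤ 1)
    {ν ν' : Measure ℝ} [IsProbabilityMeasure ν] [IsProbabilityMeasure ν'] {v : ℝ}
    (h3 : MemLp (fun y : ℝ => y) 3 ν) (hmean : ∫ y, y ∂ν = 0) (hvar : ∫ y, y ^ 2 ∂ν = v)
    (h3' : MemLp (fun y : ℝ => y) 3 ν') (hmean' : ∫ y, y ∂ν' = 0) (hvar' : ∫ y, y ^ 2 ∂ν' = v) :
    |∫ x, logSumExp S (fun σ => ∑ i, s σ i * x i) ∂(Measure.pi fun _ : ι => ν)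
      - ∫ x, logSumExp S (fun σ => ∑ i, s σ i * x i) ∂(Measure.pi fun _ : ι => ν')|
      ≤ Fintype.card ι * (6 * (∫ y, |y| ^ 3 ∂ν + ∫ y, |y| ^ 3 ∂ν')) := by
  let ρ : Finset ι → ι → Measure ℝ := fun T i => if i ∈ T then ν else ν'
  have hind : ∀ T : Finset ι,
      |∫ x, logSumExp S (fun σ => ∑ i, s σ i * x i) ∂(Measure.pi (ρ T))
      - ∫ x, logSumExp S (fun σ => ∑ i, s σ i * x i) ∂(Measure.pi fun _ : ι => ν')|
      ≤ T.card * (6 * (∫ y, |y| ^ 3 ∂ν + ∫ y, |y| ^ 3 ∂ν')) := by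
    intro T
    induction T using Finset.induction_on with
    | empty => simp [ρ]
    | insert a T ha ih =>
      have hp : ∀ i, IsProbabilityMeasure (ρ T i) := fun i => by
        simp only [ρ]; split_ifs <;> infer_instance
      have hint : ∀ i, Integrable (fun y : ℝ => y) (ρ T i) := fun i => by
        simp only [ρ]
        split_ifs
        · exact h3.integrable (by norm_num)
        · exact h3'.integrable (by norm_num)
      have e1 : ρ (insert a T) = Function.update (ρ T) a ν := by
        ext1 i
        rcases eq_or_ne i a with rfl | h
        · simp [ρ]
        · simp [ρ, h]
      have e2 : ρ T = Function.update (ρ T) a ν' := by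
        ext1 i
        rcases eq_or_ne i a with rfl | h
        · simp [ρ, ha]
        · simp [h]
      have h := abs_integral_logSumExp_update_sub_le hS s hs (ρ T) hint a h3 hmean hvar h3' hmean'
        hvar'
      rw [← e1, ← e2] at h
      rw [Finset.card_insert_of_notMem ha]
      push_cast
      have := abs_sub_le (∫ x, logSumExp S (fun σ => ∑ i, s σ i * x i)
        ∂(Measure.pi (ρ (insert a T))))
        (∫ x, logSumExp S (fun σ => ∑ i, s σ i * x i) ∂(Measure.pi (ρ T)))
        (∫ x, logSumExp S (fun σ => ∑ i, s σ i * x i) ∂(Measure.pi fun _ : ι => ν'))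
      linarith
  have h := hind Finset.univ
  simpa [ρ] using h

end Lindeberg

section Poisson

open scoped NNReal

lemma integrable_natCast_mul_poissonMeasure {r : ℝ≥0} {f : ℕ → ℝ}
    (hf : Integrable (fun k => f (k + 1)) (poissonMeasure r)) :
    Integrable (fun k : ℕ => (k : ℝ) * f k) (poissonMeasure r) := by
  rw [integrable_poissonMeasure_iff] at hf ⊢
  refine (summable_nat_add_iff 1).1 ((hf.mul_left (r : ℝ)).congr fun k => ?_)
  rw [Nat.factorial_succ, norm_mul]
  push_cast
  rw [Real.norm_of_nonneg (by positivity : (0 : ℝ) ≤ (k : ℝ) + 1)]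
  rw [pow_succ]
  field_simp

/-- The Chen–Stein identity for the Poisson distribution. -/
lemma integral_natCast_mul_poissonMeasure {r : ℝ≥0} {f : ℕ → ℝ}
    (hf : Integrable (fun k => f (k + 1)) (poissonMeasure r)) :
    ∫ k, (k : ℝ) * f k ∂(poissonMeasure r) = r * ∫ k, f (k + 1) ∂(poissonMeasure r) := by
  have h1 := hasSum_integral_poissonMeasure (integrable_natCast_mul_poissonMeasure hf)
  have h2 := (hasSum_integral_poissonMeasure hf).mul_left (r : ℝ)
  rw [← hasSum_nat_add_iff' 1] at h1
  simp only [Finset.range_one, Finset.sum_singleton, Nat.cast_zero, zero_mul, smul_zero,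
    sub_zero] at h1
  refine h1.unique (h2.congr_fun fun k => ?_)
  rw [Nat.factorial_succ]
  simp only [smul_eq_mul]
  push_cast
  rw [pow_succ]
  field_simp

end Poisson

section PoissonMoments

open scoped NNReal

lemma integrable_natCast_add_pow_poissonMeasure (r : ℝ≥0) (m : ℕ) (a : ℝ) :
    Integrable (fun k : ℕ => ((k : ℝ) + a) ^ m) (poissonMeasure r) := by
  induction m generalizing a with
  | zero => simp
  | succ m ih =>
    have h1 : Integrable (fun k : ℕ => (k : ℝ) * ((k : ℝ) + a) ^ m) (poissonMeasure r) := by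
      refine integrable_natCast_mul_poissonMeasure (f := fun k => ((k : ℝ) + a) ^ m) ?_
      refine (ih (1 + a)).congr (ae_of_all _ fun k => ?_)
      simp only
      push_cast
      ring
    refine (h1.add ((ih a).const_mul a)).congr (ae_of_all _ fun k => ?_)
    simp only [Pi.add_apply]
    ring

lemma integral_sub_poissonMeasure (r : ℝ≥0) : ∫ k, ((k : ℝ) - r) ∂(poissonMeasure r) = 0 := by
  have hk : Integrable (fun k : ℕ => (k : ℝ)) (poissonMeasure r) := by
    simpa using integrable_natCast_add_pow_poissonMeasure r 1 0
  have h := integral_natCast_mul_poissonMeasure (r := r) (f := fun _ => 1) (integrable_const _)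
  rw [integral_sub hk (integrable_const _)]
  simp only [mul_one] at h
  simp [h]

lemma integral_sub_sq_poissonMeasure (r : ℝ≥0) :
    ∫ k, ((k : ℝ) - r) ^ 2 ∂(poissonMeasure r) = r := by
  have hi : ∀ a : ℝ, Integrable (fun k : ℕ => (k : ℝ) + a) (poissonMeasure r) := fun a => by
    simpa using integrable_natCast_add_pow_poissonMeasure r 1 a
  have h1 : Integrable (fun k : ℕ => ((k + 1 : ℕ) : ℝ) - r) (poissonMeasure r) :=
    (hi (1 - r)).congr (ae_of_all _ fun k => by simp only; push_cast; ring)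
  have h := integral_natCast_mul_poissonMeasure (r := r) (f := fun k => (k : ℝ) - r) h1
  have i0 : Integrable (fun k : ℕ => (k : ℝ) - r) (poissonMeasure r) := hi (-r)
  have i1 := integrable_natCast_mul_poissonMeasure (r := r) (f := fun k => (k : ℝ) - r) h1
  have e : ∀ k : ℕ, ((k : ℝ) - r) ^ 2 = (k : ℝ) * ((k : ℝ) - r) - r * ((k : ℝ) - r) :=
    fun k => by ring
  have e1 : ∀ k : ℕ, ((k + 1 : ℕ) : ℝ) - r = ((k : ℝ) - r) + 1 := fun k => by push_cast; ring
  simp only [e]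
  rw [integral_sub i1 (i0.const_mul _), h, integral_const_mul, integral_sub_poissonMeasure]
  simp only [e1]
  rw [integral_add i0 (integrable_const _), integral_sub_poissonMeasure]
  simp

lemma integral_abs_sub_pow_three_poissonMeasure_le (r : ℝ≥0) :
    ∫ k, |(k : ℝ) - r| ^ 3 ∂(poissonMeasure r) ≤ r + 2 * (r : ℝ) ^ 2 := by
  have i0 : Integrable (fun k : ℕ => (k : ℝ) - r) (poissonMeasure r) := by
    simpa [sub_eq_add_neg] using integrable_natCast_add_pow_poissonMeasure r 1 (-r)
  have i2 : Integrable (fun k : ℕ => ((k : ℝ) - r) ^ 2) (poissonMeasure r) :=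
    integrable_natCast_add_pow_poissonMeasure r 2 (-r)
  have e1 : ∀ k : ℕ, (((k + 1 : ℕ) : ℝ) - r) ^ 2
      = ((k : ℝ) - r) ^ 2 + (2 * ((k : ℝ) - r) + 1) := fun k => by push_cast; ring
  have i3 : Integrable (fun k : ℕ => 2 * ((k : ℝ) - r) + 1) (poissonMeasure r) :=
    (i0.const_mul 2).add (integrable_const _)
  have h1 : Integrable (fun k : ℕ => (((k + 1 : ℕ) : ℝ) - r) ^ 2) (poissonMeasure r) := by
    simp only [e1]
    exact i2.add i3
  have h := integral_natCast_mul_poissonMeasure (r := r) (f := fun k => ((k : ℝ) - r) ^ 2) h1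
  have i1 := integrable_natCast_mul_poissonMeasure (r := r) (f := fun k => ((k : ℝ) - r) ^ 2) h1
  have hval : ∫ k, ((k : ℝ) * ((k : ℝ) - r) ^ 2 + r * ((k : ℝ) - r) ^ 2) ∂(poissonMeasure r)
      = r + 2 * (r : ℝ) ^ 2 := by
    rw [integral_add i1 (i2.const_mul _), h, integral_const_mul, integral_sub_sq_poissonMeasure]
    simp only [e1]
    rw [integral_add i2 i3, integral_add (i0.const_mul 2) (integrable_const _),
      integral_const_mul, integral_sub_poissonMeasure, integral_sub_sq_poissonMeasure]
    simp
    ring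
  rw [← hval]
  refine integral_mono_of_nonneg (ae_of_all _ fun k => by positivity) (i1.add (i2.const_mul _))
    (ae_of_all _ fun k => ?_)
  have h3 : |(k : ℝ) - r| ≤ k + r := by
    rw [abs_le]
    constructor <;> linarith [k.cast_nonneg (α := ℝ), r.coe_nonneg]
  have h4 := mul_le_mul_of_nonneg_right h3 (sq_nonneg ((k : ℝ) - r))
  simp only
  rw [pow_succ', sq_abs]
  linarith

/-- The law of `t (A - r)` for `A` a Poisson variable of rate `r`. -/
noncomputable def centeredPoisson (r : ℝ≥0) (t : ℝ) : Measure ℝ :=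
  (poissonMeasure r).map fun k : ℕ => t * ((k : ℝ) - r)

instance (r : ℝ≥0) (t : ℝ) : IsProbabilityMeasure (centeredPoisson r t) :=
  Measure.isProbabilityMeasure_map (by fun_prop)

lemma memLp_centeredPoisson (r : ℝ≥0) (t : ℝ) :
    MemLp (fun y : ℝ => y) 3 (centeredPoisson r t) := by
  rw [centeredPoisson, memLp_map_measure_iff (Measurable.aestronglyMeasurable (by fun_prop))
    (by fun_prop)]
  refine MemLp.const_mul ?_ t
  rw [← integrable_norm_rpow_iff (by fun_prop) (by norm_num) (by norm_num)]
  have := (integrable_natCast_add_pow_poissonMeasure r 3 (-r)).norm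
  refine this.congr (ae_of_all _ fun k => ?_)
  simp only [norm_pow]
  rw [← Real.rpow_natCast]
  norm_num [sub_eq_add_neg]

lemma integral_centeredPoisson (r : ℝ≥0) (t : ℝ) : ∫ y, y ∂(centeredPoisson r t) = 0 := by
  rw [centeredPoisson, integral_map (by fun_prop) (Measurable.aestronglyMeasurable (by fun_prop)),
    integral_const_mul, integral_sub_poissonMeasure, mul_zero]

lemma integral_sq_centeredPoisson (r : ℝ≥0) (t : ℝ) :
    ∫ y, y ^ 2 ∂(centeredPoisson r t) = t ^ 2 * r := by
  rw [centeredPoisson, integral_map (by fun_prop) (Measurable.aestronglyMeasurable (by fun_prop))]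
  simp only [mul_pow]
  rw [integral_const_mul, integral_sub_sq_poissonMeasure]

lemma integral_abs_pow_three_centeredPoisson_le (r : ℝ≥0) (t : ℝ) :
    ∫ y, |y| ^ 3 ∂(centeredPoisson r t) ≤ |t| ^ 3 * (r + 2 * (r : ℝ) ^ 2) := by
  rw [centeredPoisson, integral_map (by fun_prop) (Measurable.aestronglyMeasurable (by fun_prop))]
  simp only [abs_mul, mul_pow]
  rw [integral_const_mul]
  exact mul_le_mul_of_nonneg_left (integral_abs_sub_pow_three_poissonMeasure_le r) (by positivity)

end PoissonMoments

section GaussianMoments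

/-- The law of `t z` for `z` a standard Gaussian. -/
noncomputable def scaledGaussian (t : ℝ) : Measure ℝ :=
  (gaussianReal 0 1).map fun z => t * z

instance (t : ℝ) : IsProbabilityMeasure (scaledGaussian t) :=
  Measure.isProbabilityMeasure_map (by fun_prop)

lemma memLp_scaledGaussian (t : ℝ) : MemLp (fun y : ℝ => y) 3 (scaledGaussian t) := by
  rw [scaledGaussian, memLp_map_measure_iff (Measurable.aestronglyMeasurable (by fun_prop))
    (by fun_prop)]
  have h : MemLp (fun z : ℝ => z) 3 (gaussianReal 0 1) := memLp_id_gaussianReal 3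
  exact h.const_mul t

lemma integral_scaledGaussian (t : ℝ) : ∫ y, y ∂(scaledGaussian t) = 0 := by
  rw [scaledGaussian, integral_map (by fun_prop) (Measurable.aestronglyMeasurable (by fun_prop)),
    integral_const_mul, integral_id_gaussianReal, mul_zero]

lemma integral_sq_scaledGaussian (t : ℝ) : ∫ y, y ^ 2 ∂(scaledGaussian t) = t ^ 2 := by
  rw [scaledGaussian, integral_map (by fun_prop) (Measurable.aestronglyMeasurable (by fun_prop))]
  simp only [mul_pow]
  rw [integral_const_mul]
  have hv := variance_fun_id_gaussianReal (μ := 0) (v := 1)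
  rw [variance_eq_integral (by fun_prop)] at hv
  simp only [integral_id_gaussianReal, sub_zero, NNReal.coe_one] at hv
  rw [hv, mul_one]

lemma integral_abs_pow_three_scaledGaussian (t : ℝ) :
    ∫ y, |y| ^ 3 ∂(scaledGaussian t) = |t| ^ 3 * ∫ z, |z| ^ 3 ∂(gaussianReal 0 1) := by
  rw [scaledGaussian, integral_map (by fun_prop) (Measurable.aestronglyMeasurable (by fun_prop))]
  simp only [abs_mul, mul_pow]
  rw [integral_const_mul]

end GaussianMoments

section FreeEnergies

/-- The product of the two spins at the ends of `p`. -/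
noncomputable def pairSpin {n : ℕ} (σ : Fin n → Bool) (p : Fin n × Fin n) : ℝ :=
  spin (σ p.1) * spin (σ p.2)

lemma abs_pairSpin {n : ℕ} (σ : Fin n → Bool) (p : Fin n × Fin n) : |pairSpin σ p| = 1 := by
  rw [pairSpin, abs_mul, abs_spin, abs_spin, one_mul]

lemma Ham_eq_sum_pairSpin {n : ℕ} (X : Fin n → Fin n → ℝ) (σ : Fin n → Bool) :
    Ham X σ = ∑ p : Fin n × Fin n, pairSpin σ p * X p.1 p.2 := by
  rw [Ham, Fintype.sum_prod_type]
  refine Finset.sum_congr rfl fun i _ => Finset.sum_congr rfl fun j _ => ?_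
  simp only [pairSpin]
  ring

lemma sum_pairSpin {n : ℕ} (σ : Fin n → Bool) :
    ∑ p : Fin n × Fin n, pairSpin σ p = (∑ i, spin (σ i)) ^ 2 := by
  rw [Fintype.sum_prod_type, sq, Finset.sum_mul_sum]
  rfl

lemma exists_sum_pairSpin_eq (n : ℕ) :
    ∃ q : ℝ, |q| ≤ 1 ∧ ∀ σ ∈ bisections n, ∑ p : Fin n × Fin n, pairSpin σ p = q := by
  rcases Nat.even_or_odd n with h | h
  · refine ⟨0, by simp, fun σ hσ => ?_⟩
    rw [sum_pairSpin, sum_spin_eq_zero_of_even h hσ]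
    simp
  · refine ⟨1, by simp, fun σ hσ => ?_⟩
    rw [sum_pairSpin]
    rcases sum_spin_of_odd h hσ with h | h <;> simp [h]

lemma map_matrix_pi {n : ℕ} {E : Type*} [MeasurableSpace E] (ρ : Measure E)
    [IsProbabilityMeasure ρ] {φ : E → ℝ} (hφ : Measurable φ) :
    (Measure.pi fun _ : Fin n => Measure.pi fun _ : Fin n => ρ).map
      (fun A (p : Fin n × Fin n) => φ (A p.1 p.2)) = Measure.pi fun _ => ρ.map φ := by
  have := Measure.isProbabilityMeasure_map (μ := ρ) hφ.aemeasurable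
  symm
  refine Measure.pi_eq fun t ht => ?_
  rw [Measure.map_apply (by fun_prop) (MeasurableSet.univ_pi ht)]
  have hset : (fun (A : Fin n → Fin n → E) (p : Fin n × Fin n) => φ (A p.1 p.2)) ⁻¹'
      Set.univ.pi t = Set.univ.pi fun i => Set.univ.pi fun j => φ ⁻¹' t (i, j) := by
    ext A
    simp [Set.mem_pi, Prod.forall]
  rw [hset, Measure.pi_pi, Fintype.prod_prod_type]
  refine Finset.prod_congr rfl fun i _ => ?_
  rw [Measure.pi_pi]
  refine Finset.prod_congr rfl fun j _ => ?_
  rw [Measure.map_apply hφ (ht _)]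

lemma integral_logSumExp_matrix {n : ℕ} {E : Type*} [MeasurableSpace E] (ρ : Measure E)
    [IsProbabilityMeasure ρ] {φ : E → ℝ} (hφ : Measurable φ) (S : Finset (Fin n → Bool)) :
    ∫ A, logSumExp S (fun σ => ∑ p : Fin n × Fin n, pairSpin σ p * φ (A p.1 p.2))
      ∂(Measure.pi fun _ : Fin n => Measure.pi fun _ : Fin n => ρ)
    = ∫ x, logSumExp S (fun σ => ∑ p, pairSpin σ p * x p) ∂(Measure.pi fun _ => ρ.map φ) := by
  rw [← map_matrix_pi ρ hφ, integral_map (Measurable.aemeasurable (by fun_prop))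
    (measurable_logSumExp (by fun_prop)).aestronglyMeasurable]

lemma gaussianReal_map_eq_scaledGaussian (n : ℕ) (β : ℝ) :
    (gaussianReal 0 (1 / (2 * n))).map (fun x => -β * x)
      = scaledGaussian (-β * Real.sqrt (1 / (2 * n))) := by
  rw [scaledGaussian, gaussianReal_map_const_mul, gaussianReal_map_const_mul]
  simp only [mul_zero]
  congr 1
  ext
  push_cast
  rw [mul_pow, Real.sq_sqrt (by positivity)]
  simp

lemma skFree_eq_integral_scaledGaussian (n : ℕ) (β : ℝ) :
    skFree n β = ∫ x, logSumExp (bisections n) (fun σ => ∑ p, pairSpin σ p * x p)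
      ∂(Measure.pi fun _ => scaledGaussian (-β * Real.sqrt (1 / (2 * n)))) := by
  rw [skFree, integral_logSumExp_gaussLaw_eq]
  simp only [scaledGaussian]
  rw [← Measure.pi_map_pi (fun _ => by fun_prop),
    integral_map (Measurable.aemeasurable (by fun_prop))
      (measurable_logSumExp (by fun_prop)).aestronglyMeasurable]
  simp only [skCoeff, pairSpin]
  refine integral_congr_ae (ae_of_all _ fun z => ?_)
  simp only
  congr with σ
  refine Finset.sum_congr rfl fun p _ => ?_
  ring

/-- The expected log-partition function written over the SK disorder. -/
lemma skFree_eq_integral_skMeasure (n : ℕ) (β : ℝ) :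
    skFree n β = ∫ g, logSumExp (bisections n) (fun σ => -β * Ham g σ) ∂(skMeasure n) := by
  have h := integral_logSumExp_matrix (n := n) (gaussianReal 0 (1 / (2 * n)))
    (φ := fun x => -β * x) (by fun_prop) (bisections n)
  rw [gaussianReal_map_eq_scaledGaussian] at h
  rw [skFree_eq_integral_scaledGaussian, ← h, skMeasure]
  simp only [Ham_eq_sum_pairSpin, Finset.mul_sum, mul_left_comm]

/-- The expected log-partition function of the rescaled bisection sparse model. -/
noncomputable def sparseFree (n : ℕ) (d β : ℝ) : ℝ :=
  ∫ A, logSumExp (bisections n) (fun σ => -(β / Real.sqrt d) * Ham (natMat A) σ)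
    ∂(sparseMeasure n d)

lemma logSumExp_add_const {α : Type*} {S : Finset α} (hS : S.Nonempty) (w : α → ℝ) (a : ℝ) :
    logSumExp S (fun σ => w σ + a) = logSumExp S w + a := by
  simp only [logSumExp, Real.exp_add, ← Finset.sum_mul]
  rw [Real.log_mul (sum_exp_pos hS w).ne' (Real.exp_pos a).ne', Real.log_exp]

lemma logSumExp_congr {α : Type*} {S : Finset α} {w w' : α → ℝ} (h : ∀ σ ∈ S, w σ = w' σ) :
    logSumExp S w = logSumExp S w' := by
  rw [logSumExp, logSumExp, Finset.sum_congr rfl fun σ hσ => by rw [h σ hσ]]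

lemma abs_sparseFree_sub_le (n : ℕ) {d : ℝ} (hd : 0 < d) (β : ℝ) :
    |sparseFree n d β - ∫ x, logSumExp (bisections n) (fun σ => ∑ p, pairSpin σ p * x p)
      ∂(Measure.pi fun _ => centeredPoisson (d / (2 * n)).toNNReal (-(β / Real.sqrt d)))|
      ≤ |β / Real.sqrt d| * (d / (2 * n)) := by
  obtain ⟨q, hq, hsum⟩ := exists_sum_pairSpin_eq n
  set r := (d / (2 * n)).toNNReal with hr
  have hr' : (r : ℝ) = d / (2 * n) := Real.coe_toNNReal _ (by positivity)
  set t := -(β / Real.sqrt d) with ht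
  have h := integral_logSumExp_matrix (n := n) (poissonMeasure r)
    (φ := fun k : ℕ => t * ((k : ℝ) - r)) (by fun_prop) (bisections n)
  rw [centeredPoisson, ← h]
  have hpt : ∀ A : Fin n → Fin n → ℕ, logSumExp (bisections n) (fun σ => t * Ham (natMat A) σ)
      = logSumExp (bisections n)
        (fun σ => ∑ p : Fin n × Fin n, pairSpin σ p * (t * ((A p.1 p.2 : ℝ) - r)))
        + t * r * q := by
    intro A
    rw [← logSumExp_add_const (bisections_nonempty n)]
    refine logSumExp_congr fun σ hσ => ?_
    rw [Ham_eq_sum_pairSpin, ← hsum σ hσ, Finset.mul_sum, Finset.mul_sum,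
      ← Finset.sum_add_distrib]
    refine Finset.sum_congr rfl fun p _ => ?_
    simp only [natMat]
    ring
  have hint : Integrable (fun A : Fin n → Fin n → ℕ => logSumExp (bisections n)
        (fun σ => ∑ p : Fin n × Fin n, pairSpin σ p * (t * ((A p.1 p.2 : ℝ) - r))))
      (Measure.pi fun _ : Fin n => Measure.pi fun _ : Fin n => poissonMeasure r) := by
    refine integrable_logSumExp (bisections_nonempty n) (by fun_prop) fun σ => ?_
    refine integrable_finsetSum _ fun p _ => Integrable.const_mul (Integrable.const_mul ?_ _) _
    have i0 : Integrable (fun k : ℕ => (k : ℝ) - r) (poissonMeasure r) := by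
      simpa [sub_eq_add_neg] using integrable_natCast_add_pow_poissonMeasure r 1 (-r)
    have i1 : Integrable (fun a : Fin n → ℕ => (a p.2 : ℝ) - r)
        (Measure.pi fun _ : Fin n => poissonMeasure r) :=
      integrable_comp_eval (μ := fun _ : Fin n => poissonMeasure r) (i := p.2)
        (f := fun k : ℕ => (k : ℝ) - r) i0
    exact integrable_comp_eval
      (μ := fun _ : Fin n => Measure.pi fun _ : Fin n => poissonMeasure r) (i := p.1)
      (f := fun a : Fin n → ℕ => (a p.2 : ℝ) - r) i1
  rw [sparseFree, sparseMeasure]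
  simp only [← ht, ← hr, hpt]
  rw [integral_add hint (integrable_const _)]
  simp only [integral_const, probReal_univ, one_smul, add_sub_cancel_left]
  rw [abs_mul, abs_mul, hr', ht, abs_neg, abs_of_nonneg (by positivity : 0 ≤ d / (2 * (n : ℝ)))]
  exact mul_le_of_le_one_right (by positivity) hq

end FreeEnergies

section FreeEnergyComparison

lemma abs_skFree_sub_sparseFree_le {n : ℕ} (hn : 0 < n) {d : ℝ} (hd : 0 < d) (β : ℝ) :
    |skFree n β - sparseFree n d β| ≤
      (3 * |β| ^ 3 * (∫ z, |z| ^ 3 ∂(gaussianReal 0 1)) * Real.sqrt (1 / (2 * n))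
        + 6 * |β / Real.sqrt d| ^ 3 * (d / 2 + d * (d / (2 * n)))
        + |β / Real.sqrt d| * (d / (2 * n))) * n := by
  have hn1 : (1 : ℝ) ≤ n := by exact_mod_cast hn
  have hr : ((d / (2 * n)).toNNReal : ℝ) = d / (2 * n) := Real.coe_toNNReal _ (by positivity)
  have h1 := abs_integral_logSumExp_pi_sub_le (bisections_nonempty n) pairSpin
    (fun σ _ p => (abs_pairSpin σ p).le)
    (memLp_scaledGaussian (-β * Real.sqrt (1 / (2 * n)))) (integral_scaledGaussian _)
    (integral_sq_scaledGaussian _)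
    (memLp_centeredPoisson (d / (2 * n)).toNNReal (-(β / Real.sqrt d)))
    (integral_centeredPoisson _ _)
    (by
      rw [integral_sq_centeredPoisson, hr, neg_sq, div_pow, Real.sq_sqrt hd.le, mul_pow, neg_sq,
        Real.sq_sqrt (by positivity)]
      field_simp)
  rw [← skFree_eq_integral_scaledGaussian, integral_abs_pow_three_scaledGaussian,
    Fintype.card_prod, Fintype.card_fin] at h1
  have h2 := integral_abs_pow_three_centeredPoisson_le (d / (2 * n)).toNNReal
    (-(β / Real.sqrt d))
  rw [hr, abs_neg] at h2
  have h3 := abs_sparseFree_sub_le n hd β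
  rw [abs_sub_comm] at h3
  refine (abs_sub_le _ _ _).trans ((add_le_add h1 h3).trans ?_)
  have h4 : |β / Real.sqrt d| * (d / (2 * n)) ≤ |β / Real.sqrt d| * (d / (2 * n)) * n :=
    le_mul_of_one_le_right (by positivity) hn1
  have hcube : |-β * Real.sqrt (1 / (2 * n))| ^ 3
      = |β| ^ 3 * (1 / (2 * n) * Real.sqrt (1 / (2 * n))) := by
    rw [abs_mul, abs_neg, abs_of_nonneg (Real.sqrt_nonneg _), mul_pow, pow_succ (Real.sqrt _),
      Real.sq_sqrt (by positivity)]
  rw [hcube]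
  push_cast
  have h5 := mul_le_mul_of_nonneg_left h2 (by positivity : (0 : ℝ) ≤ n * n * 6)
  have h6 : (n : ℝ) * n * 6 * (|β / Real.sqrt d| ^ 3 * (d / (2 * n) + 2 * (d / (2 * n)) ^ 2))
      = 6 * |β / Real.sqrt d| ^ 3 * (d / 2 + d * (d / (2 * n))) * n := by
    field_simp
  have h7 : (n : ℝ) * n * 6 * (|β| ^ 3 * (1 / (2 * n) * Real.sqrt (1 / (2 * n)))
        * ∫ z, |z| ^ 3 ∂(gaussianReal 0 1))
      = 3 * |β| ^ 3 * (∫ z, |z| ^ 3 ∂(gaussianReal 0 1)) * Real.sqrt (1 / (2 * n)) * n := by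
    field_simp
    ring
  rw [h6] at h5
  linear_combination h5 + h4 + h7

lemma eventually_abs_skFree_sub_sparseFree_le (β : ℝ) {d ε : ℝ} (hd : 0 < d) (hε : 0 < ε) :
    ∀ᶠ n : ℕ in atTop,
      |skFree n β - sparseFree n d β| ≤ (3 * |β| ^ 3 / Real.sqrt d + ε) * n := by
  have ht : ∀ c : ℝ, Tendsto (fun n : ℕ => c / (2 * n)) atTop (nhds 0) := fun c =>
    (tendsto_natCast_atTop_atTop.const_mul_atTop two_pos).const_div_atTop c
  have hs : Tendsto (fun n : ℕ => Real.sqrt (1 / (2 * n))) atTop (nhds 0) := by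
    simpa using (ht 1).sqrt
  have hlim : Tendsto (fun n : ℕ =>
      3 * |β| ^ 3 * (∫ z, |z| ^ 3 ∂(gaussianReal 0 1)) * Real.sqrt (1 / (2 * n))
        + 6 * |β / Real.sqrt d| ^ 3 * (d / 2 + d * (d / (2 * n)))
        + |β / Real.sqrt d| * (d / (2 * n))) atTop (nhds (3 * |β| ^ 3 / Real.sqrt d)) := by
    have h := ((hs.const_mul (3 * |β| ^ 3 * ∫ z, |z| ^ 3 ∂(gaussianReal 0 1))).add
      ((((ht d).const_mul d).const_add (d / 2)).const_mul (6 * |β / Real.sqrt d| ^ 3))).add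
      ((ht d).const_mul |β / Real.sqrt d|)
    convert h using 2
    have hd' : Real.sqrt d ≠ 0 := (Real.sqrt_pos.2 hd).ne'
    rw [abs_div, abs_of_nonneg (Real.sqrt_nonneg d), div_pow]
    field_simp
    rw [Real.sq_sqrt hd.le]
    ring
  filter_upwards [hlim.eventually_le_const (lt_add_of_pos_right _ hε), eventually_gt_atTop 0]
    with n hn hn0
  exact (abs_skFree_sub_sparseFree_le hn0 hd β).trans
    (mul_le_mul_of_nonneg_right hn n.cast_nonneg)

end FreeEnergyComparison

section Tangent

lemma integral_logSumExp_sub_le {α : Type*} {S : Finset α} (hS : S.Nonempty) {Ω : Type*}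
    [MeasurableSpace Ω] {μ : Measure Ω} [IsProbabilityMeasure μ] {H : Ω → α → ℝ}
    (hm : ∀ σ, Measurable fun ω => H ω σ) (hi : ∀ σ, Integrable (fun ω => H ω σ) μ) (β δ : ℝ) :
    ∫ ω, logSumExp S (fun σ => -β * H ω σ) ∂μ
      - δ * ∫ ω, expAvg S (fun σ => -β * H ω σ) (H ω) ∂μ
      ≤ ∫ ω, logSumExp S (fun σ => -(β + δ) * H ω σ) ∂μ := by
  have hL : ∀ b : ℝ, Integrable (fun ω => logSumExp S (fun σ => -b * H ω σ)) μ := fun b =>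
    integrable_logSumExp hS (fun σ => (hm σ).const_mul _) fun σ => (hi σ).const_mul _
  have hE : Integrable (fun ω => expAvg S (fun σ => -β * H ω σ) (H ω)) μ :=
    Integrable.mono' (g := fun ω => ∑ σ ∈ S, |H ω σ|)
      (integrable_finsetSum _ fun σ _ => (hi σ).abs)
      (measurable_expAvg (fun σ => (hm σ).const_mul _) hm).aestronglyMeasurable
      (ae_of_all _ fun ω => abs_expAvg_le hS _ _ fun σ hσ =>
        Finset.single_le_sum (f := fun σ => |H ω σ|) (fun _ _ => abs_nonneg _) hσ)
  rw [← integral_const_mul, ← integral_sub (hL β) (hE.const_mul δ)]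
  refine integral_mono ((hL β).sub (hE.const_mul δ)) (hL _) fun ω => ?_
  have h := logSumExp_add_expAvg_le hS (fun σ => -β * H ω σ) (fun σ => -δ * H ω σ)
  rw [expAvg_mul_left] at h
  have e : (fun σ => -(β + δ) * H ω σ) = fun σ => -β * H ω σ + -δ * H ω σ := by
    ext σ; ring
  simp only [e]
  linarith

lemma avg1Bis_eq_expAvg {n : ℕ} (β : ℝ) (X : Fin n → Fin n → ℝ) (f : (Fin n → Bool) → ℝ) :
    avg1Bis β X f = expAvg (bisections n) (fun σ => -β * Ham X σ) f := by
  classical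
  have hZ : ZpartBis β X = ∑ σ ∈ bisections n, Real.exp (-β * Ham X σ) := by
    rw [ZpartBis, bisections, Finset.sum_filter]
  rw [avg1Bis, expAvg, ← hZ, Finset.sum_div, bisections, Finset.sum_filter]
  refine Finset.sum_congr rfl fun σ _ => ?_
  simp only [gibbsBis]
  split_ifs <;> ring

lemma integrable_Ham_pi {n : ℕ} {E : Type*} [MeasurableSpace E] {ρ : Measure E}
    [IsProbabilityMeasure ρ] {φ : E → ℝ} (hφ : Integrable φ ρ) (σ : Fin n → Bool) :
    Integrable (fun A : Fin n → Fin n → E => Ham (fun i j => φ (A i j)) σ)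
      (Measure.pi fun _ : Fin n => Measure.pi fun _ : Fin n => ρ) := by
  refine integrable_finsetSum _ fun i _ => integrable_finsetSum _ fun j _ =>
    Integrable.mul_const (Integrable.mul_const ?_ _) _
  have h1 : Integrable (fun a : Fin n → E => φ (a j)) (Measure.pi fun _ : Fin n => ρ) :=
    integrable_comp_eval (μ := fun _ : Fin n => ρ) (i := j) hφ
  exact integrable_comp_eval (μ := fun _ : Fin n => Measure.pi fun _ : Fin n => ρ) (i := i)
    (f := fun a : Fin n → E => φ (a j)) h1

lemma skFree_sub_le (n : ℕ) (β δ : ℝ) :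
    skFree n β - δ * ∫ g, avg1Bis β g (Ham g) ∂(skMeasure n) ≤ skFree n (β + δ) := by
  have hi : Integrable (fun x : ℝ => x) (gaussianReal 0 (1 / (2 * n))) :=
    memLp_one_iff_integrable.1 (memLp_id_gaussianReal 1)
  simp only [skFree_eq_integral_skMeasure, avg1Bis_eq_expAvg, skMeasure]
  exact integral_logSumExp_sub_le (bisections_nonempty n)
    (fun σ => by unfold Ham; fun_prop) (integrable_Ham_pi hi) β δ

lemma sparseFree_sub_le (n : ℕ) (d β δ : ℝ) :
    sparseFree n d β - δ * (1 / Real.sqrt d *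
        ∫ A, avg1Bis (β / Real.sqrt d) (natMat A) (Ham (natMat A)) ∂(sparseMeasure n d))
      ≤ sparseFree n d (β + δ) := by
  have hi : Integrable (fun k : ℕ => (k : ℝ)) (poissonMeasure (d / (2 * n)).toNNReal) := by
    simpa using integrable_natCast_add_pow_poissonMeasure (d / (2 * n)).toNNReal 1 0
  have h := integral_logSumExp_sub_le (bisections_nonempty n)
    (H := fun A => Ham (natMat A)) (fun σ => by unfold Ham natMat; fun_prop)
    (integrable_Ham_pi hi) (β / Real.sqrt d) (δ / Real.sqrt d)
  simp only [sparseFree, avg1Bis_eq_expAvg, sparseMeasure, add_div]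
  refine le_trans (le_of_eq ?_) h
  ring

end Tangent

section EnergyComparison

lemma eventually_abs_energy_sub_le (β : ℝ) {d δ : ℝ} (hd : 0 < d) (hδ : 0 < δ) :
    ∀ᶠ n : ℕ in atTop,
      (1 / (n : ℝ)) * |(∫ g, avg1Bis β g (Ham g) ∂(skMeasure n)) - (1 / Real.sqrt d) *
        ∫ A, avg1Bis (β / Real.sqrt d) (natMat A) (Ham (natMat A)) ∂(sparseMeasure n d)|
      ≤ 11 / 2 * δ + 6 * (|β| + δ) ^ 3 / δ / Real.sqrt d := by
  have hmono : ∀ b : ℝ, |b| ≤ |β| + δ →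
      3 * |b| ^ 3 / Real.sqrt d ≤ 3 * (|β| + δ) ^ 3 / Real.sqrt d := fun b hb => by gcongr
  filter_upwards [eventually_skFree_second_difference_le β δ (pow_pos hδ 2),
    eventually_abs_skFree_sub_sparseFree_le β hd (pow_pos hδ 2),
    eventually_abs_skFree_sub_sparseFree_le (β + δ) hd (pow_pos hδ 2),
    eventually_abs_skFree_sub_sparseFree_le (β - δ) hd (pow_pos hδ 2),
    eventually_gt_atTop 0] with n h2 e0 e1 e2 hn
  have hn0 : (0 : ℝ) < n := by exact_mod_cast hn
  have a1 := skFree_sub_le n β δ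
  have a2 := skFree_sub_le n β (-δ)
  have b1 := sparseFree_sub_le n d β δ
  have b2 := sparseFree_sub_le n d β (-δ)
  rw [← sub_eq_add_neg] at a2 b2
  set D := ∫ g, avg1Bis β g (Ham g) ∂(skMeasure n)
  set E := 1 / Real.sqrt d *
    ∫ A, avg1Bis (β / Real.sqrt d) (natMat A) (Ham (natMat A)) ∂(sparseMeasure n d)
  set K := 3 * (|β| + δ) ^ 3 / Real.sqrt d with hK
  have m0 := mul_le_mul_of_nonneg_right (hmono β (by linarith)) hn0.le
  have m1 := mul_le_mul_of_nonneg_right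
    (hmono (β + δ) ((abs_add_le _ _).trans (by rw [abs_of_pos hδ]))) hn0.le
  have m2 := mul_le_mul_of_nonneg_right
    (hmono (β - δ) ((abs_sub _ _).trans (by rw [abs_of_pos hδ]))) hn0.le
  rw [abs_le] at e0 e1 e2
  obtain ⟨l0, u0⟩ := e0
  obtain ⟨l1, u1⟩ := e1
  obtain ⟨l2, u2⟩ := e2
  have key : δ * |D - E| ≤ (11 / 2 * δ ^ 2 + 2 * K) * n := by
    rcases abs_cases (D - E) with ⟨h, -⟩ | ⟨h, -⟩ <;> rw [h] <;> linarith
  have hD : |D - E| ≤ (11 / 2 * δ + 2 * K / δ) * n := by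
    rw [← mul_le_mul_iff_right₀ hδ]
    refine key.trans (le_of_eq ?_)
    field_simp
  rw [one_div, inv_mul_le_iff₀ hn0, mul_comm (n : ℝ)]
  refine hD.trans (mul_le_mul_of_nonneg_right ?_ hn0.le)
  have : 2 * K / δ = 6 * (|β| + δ) ^ 3 / δ / Real.sqrt d := by rw [hK]; ring
  linarith

end EnergyComparison

/-- average-energy correspondence between the SK model and the
sparse model for the bisection Gibbs measures. -/
theorem stmt_3 (β : ℝ) :
    Tendsto (fun d : ℝ =>
      limsup (fun n : ℕ =>
        (1 / (n : ℝ)) *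
          |(∫ g, avg1Bis β g (Ham g) ∂(skMeasure n)) -
            (1 / Real.sqrt d) *
              ∫ A, avg1Bis (β / Real.sqrt d) (natMat A) (Ham (natMat A)) ∂(sparseMeasure n d)|)
        atTop)
      atTop (nhds 0) := by
  rw [Metric.tendsto_nhds]
  intro η hη
  have hδ : 0 < η / 11 := by positivity
  have hlim : Tendsto (fun d : ℝ => 11 / 2 * (η / 11) +
      6 * (|β| + η / 11) ^ 3 / (η / 11) / Real.sqrt d) atTop (nhds (11 / 2 * (η / 11) + 0)) :=
    (Real.tendsto_sqrt_atTop.const_div_atTop _).const_add _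
  filter_upwards [eventually_gt_atTop 0, hlim.eventually_lt_const (by linarith : _ < η)]
    with d hd hdη
  have hle := eventually_abs_energy_sub_le β hd hδ
  set u := fun n : ℕ => (1 / (n : ℝ)) * |(∫ g, avg1Bis β g (Ham g) ∂(skMeasure n)) -
    (1 / Real.sqrt d) *
      ∫ A, avg1Bis (β / Real.sqrt d) (natMat A) (Ham (natMat A)) ∂(sparseMeasure n d)|
  have hnn : ∀ n, 0 ≤ u n := fun n => by positivity
  have hbdd : IsBoundedUnder (· ≤ ·) atTop u := ⟨_, hle⟩
  have hcobdd : IsCoboundedUnder (· ≤ ·) atTop u :=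
    IsBoundedUnder.isCoboundedUnder_le ⟨0, eventually_map.2 (Eventually.of_forall hnn)⟩
  have h0 : 0 ≤ limsup u atTop :=
    le_limsup_of_frequently_le (Frequently.of_forall hnn) hbdd
  rw [Real.dist_eq, sub_zero, abs_of_nonneg h0]
  exact (limsup_le_of_le hcobdd hle).trans_lt hdη
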